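/- Let U ⊂ G be open, f ∈ C¹_G(U, ℝ) with X₁f(Q) > 0 for all Q ∈ U, let 𝒪 ⊂ ℝ^{m−1} × ℝ^n be open, and let ψ : 𝒪 → ℝ be continuous with Φ(𝒪) ⊂ U and {P ∈ U : f(P) = 0} = graph(ψ). Then: (i) ψ is uniformly intrinsically differentiable at every point of 𝒪, with intrinsic gradient ∇^ψψ(A) = −(X₂f/X₁f, …, X_mf/X₁f)(Φ(A)) for all A ∈ 𝒪, which is continuous on 𝒪; (ii) writing w_j(A) := −(X_jf/X₁f)(Φ(A)) for j = 2,…,m, the equation D_j^ψψ = w_j holds in the sense of distributions: for every test function η ∈ C_c^∞(𝒪, ℝ) and every j = 2,…,m, ∫_𝒪 [ ψ·∂_{x_j}η + Σ_{s=1}^n ( ½ψ²·b^s_{j1} + ½(Σ_{l=2}^m x_l·b^s_{jl})·ψ )·∂_{y_s}η ] dL^{m+n−1} = −∫_𝒪 w_j·η dL^{m+n−1}, where L^{m+n−1} is the Lebesgue measure on ℝ^{m−1} × ℝ^n. -/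

import Mathlib

noncomputable section

open Set Filter Topology MeasureTheory

namespace Carnot

/-- Euclidean norm on `Fin d → ℝ`. -/
def enorm {d : ℕ} (x : Fin d → ℝ) : ℝ := Real.sqrt (∑ i, (x i) ^ 2)

/-- The underlying set of the Carnot group `G = ℝ^m × ℝ^n` of class `𝓑`. -/
abbrev G (m n : ℕ) := (Fin m → ℝ) × (Fin n → ℝ)

/-- Points of the normal complement `W`, identified with `ℝ^(m-k) × ℝ^n`. -/
abbrev W (m n k : ℕ) := (Fin (m - k) → ℝ) × (Fin n → ℝ)

/-- The group law of the Carnot group of class `𝓑` associated with the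
skew-symmetric matrices `b s`:
`(x,y)·(x',y') = (x + x', y + y' + ½⟨Bx,x'⟩)`. -/
def gmul {m n : ℕ} (b : Fin n → Matrix (Fin m) (Fin m) ℝ) (P Q : G m n) : G m n :=
  (P.1 + Q.1, fun s => P.2 s + Q.2 s + (1 / 2) * ∑ i, ∑ j, b s i j * P.1 j * Q.1 i)

/-- The group inverse `(x,y)⁻¹ = (-x,-y)`. -/
def ginv {m n : ℕ} (P : G m n) : G m n := (-P.1, -P.2)

/-- The homogeneous quasi-norm `N(x,y) = |x| + |y|^(1/2)`. -/
def qnorm {m n : ℕ} (P : G m n) : ℝ := enorm P.1 + Real.sqrt (enorm P.2)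

/-- Open ball for the quasi-norm: `U(P,r) = {Q : N(P⁻¹·Q) < r}`. -/
def ball (m n : ℕ) (b : Fin n → Matrix (Fin m) (Fin m) ℝ) (P : G m n) (r : ℝ) : Set (G m n) :=
  {Q | qnorm (gmul b (ginv P) Q) < r}

/-- The embedding `i : ℝ^(m-k) × ℝ^n → G`, `i(a,α) = (0,…,0,a,α)`. -/
def embW (m n k : ℕ) (A : W m n k) : G m n :=
  (fun j => if h : (j : ℕ) < k then 0 else A.1 ⟨(j : ℕ) - k, by have := j.isLt; omega⟩, A.2)

/-- The embedding of `ℝ^k` as the horizontal subgroup `H`, `v ↦ (v,0,…,0)`. -/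
def embH (m n k : ℕ) (v : Fin k → ℝ) : G m n :=
  (fun j => if h : (j : ℕ) < k then v ⟨(j : ℕ), h⟩ else 0, 0)

/-- The graph map `Φ(A) = i(A)·φ̂(A)`. -/
def graphMap (m n k : ℕ) (b : Fin n → Matrix (Fin m) (Fin m) ℝ)
    (φ : W m n k → Fin k → ℝ) (A : W m n k) : G m n :=
  gmul b (embW m n k A) (embH m n k (φ A))

/-- `N(i(A)⁻¹·i(B))`. -/
def dW (m n k : ℕ) (b : Fin n → Matrix (Fin m) (Fin m) ℝ) (A B : W m n k) : ℝ :=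
  qnorm (gmul b (ginv (embW m n k A)) (embW m n k B))

/-- The graph quasi-distance `σ_φ(A,B) = N(φ̂(A)⁻¹·i(A)⁻¹·i(B)·φ̂(A))`. -/
def sigma (m n k : ℕ) (b : Fin n → Matrix (Fin m) (Fin m) ℝ)
    (φ : W m n k → Fin k → ℝ) (A B : W m n k) : ℝ :=
  qnorm (gmul b (gmul b (gmul b (ginv (embH m n k (φ A))) (ginv (embW m n k A)))
    (embW m n k B)) (embH m n k (φ A)))

/-- The matrix `M` satisfies the uniform intrinsic differentiability condition of `φ`
at `A₀ ∈ 𝒪`. -/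
def UID (m n k : ℕ) (b : Fin n → Matrix (Fin m) (Fin m) ℝ) (O : Set (W m n k))
    (φ : W m n k → Fin k → ℝ) (A₀ : W m n k) (M : Matrix (Fin k) (Fin (m - k)) ℝ) : Prop :=
  ∀ ε > 0, ∃ r > 0, ∀ A ∈ O, ∀ B ∈ O,
    dW m n k b A₀ A < r → dW m n k b A B < r → 0 < dW m n k b A B →
    enorm (fun j => φ B j - φ A j - ∑ i, M j i * (B.1 i - A.1 i)) ≤ ε * sigma m n k b φ A B

/-- `f : U → ℝ^k` is of class `C¹_G` with (continuous) horizontal Jacobian `gradf`. -/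
def C1G (m n k : ℕ) (b : Fin n → Matrix (Fin m) (Fin m) ℝ) (U : Set (G m n))
    (f : G m n → Fin k → ℝ) (gradf : G m n → Matrix (Fin k) (Fin m) ℝ) : Prop :=
  ContinuousOn f U ∧ ContinuousOn gradf U ∧
  ∀ P ∈ U, ∀ ε > 0, ∃ r > 0, ∀ Q ∈ U,
    qnorm (gmul b (ginv P) Q) < r →
    enorm (fun j => f Q j - f P j - ∑ i, gradf P j i * (Q.1 i - P.1 i)) ≤
      ε * qnorm (gmul b (ginv P) Q)

/-- The square block `M₁(Q) = (X_i f_j(Q))_{j,i=1,…,k}` of the horizontal Jacobian. -/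
def M1 (m n k : ℕ) (hk : k ≤ m) (gradf : G m n → Matrix (Fin k) (Fin m) ℝ) (Q : G m n) :
    Matrix (Fin k) (Fin k) ℝ :=
  Matrix.of fun j i => gradf Q j (Fin.castLE hk i)

/-- The block `M₂(Q) = (X_{k+i} f_j(Q))_{j=1,…,k; i=1,…,m-k}` of the horizontal Jacobian. -/
def M2 (m n k : ℕ) (gradf : G m n → Matrix (Fin k) (Fin m) ℝ) (Q : G m n) :
    Matrix (Fin k) (Fin (m - k)) ℝ :=
  Matrix.of fun j i => gradf Q j ⟨k + (i : ℕ), by have := i.isLt; omega⟩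

/-! ### The codimension-one case `k = 1` -/

/-- The index of the variable `x_{j+1}`, `j ∈ {2,…,m}`, inside `Fin m`
(recall that points of `ℝ^{m-1} × ℝ^n` are written `(x₂,…,x_m,y₁,…,y_n)`). -/
def idx1 (m : ℕ) (i : Fin (m - 1)) : Fin m := ⟨(i : ℕ) + 1, by have := i.isLt; omega⟩

/-- Scalar version of `C1G`: `f : U → ℝ` of class `C¹_G` with horizontal
gradient `∇_G f = (X₁f,…,X_mf)`. -/
def C1Gs (m n : ℕ) (b : Fin n → Matrix (Fin m) (Fin m) ℝ) (U : Set (G m n))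
    (f : G m n → ℝ) (gradf : G m n → Fin m → ℝ) : Prop :=
  ContinuousOn f U ∧ ContinuousOn gradf U ∧
  ∀ P ∈ U, ∀ ε > 0, ∃ r > 0, ∀ Q ∈ U,
    qnorm (gmul b (ginv P) Q) < r →
    |f Q - f P - ∑ i, gradf P i * (Q.1 i - P.1 i)| ≤ ε * qnorm (gmul b (ginv P) Q)

/-- `ψ : 𝒪 → ℝ` is uniformly intrinsically differentiable at `A₀` with intrinsic
gradient `g ∈ ℝ^{m-1}` (scalar version of `UID`). -/
def UIDs (m n : ℕ) (b : Fin n → Matrix (Fin m) (Fin m) ℝ) (O : Set (W m n 1))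
    (ψ : W m n 1 → ℝ) (A₀ : W m n 1) (g : Fin (m - 1) → ℝ) : Prop :=
  ∀ ε > 0, ∃ r > 0, ∀ A ∈ O, ∀ B ∈ O,
    dW m n 1 b A₀ A < r → dW m n 1 b A B < r → 0 < dW m n 1 b A B →
    |ψ B - ψ A - ∑ i, g i * (B.1 i - A.1 i)| ≤
      ε * sigma m n 1 b (fun A' _ => ψ A') A B

/-- The graph map `Φ(A) = i(A)·ψ̂(A)` for a scalar `ψ`. -/
def graphMapS (m n : ℕ) (b : Fin n → Matrix (Fin m) (Fin m) ℝ)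
    (ψ : W m n 1 → ℝ) (A : W m n 1) : G m n :=
  graphMap m n 1 b (fun A' _ => ψ A') A

/-- The intrinsic derivative `D_j^ψ ψ` of a (C¹) function `ψ : ℝ^{m-1} × ℝ^n → ℝ`:
`D_j^ψψ = ∂_{x_j}ψ + Σ_s (ψ b^s_{j1} + ½ Σ_l x_l b^s_{jl}) ∂_{y_s}ψ`. -/
def Dj (m n : ℕ) (h0 : 0 < m) (b : Fin n → Matrix (Fin m) (Fin m) ℝ)
    (ψ : W m n 1 → ℝ) (j : Fin (m - 1)) (A : W m n 1) : ℝ :=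
  fderiv ℝ ψ A ((Pi.single j 1 : Fin (m - 1) → ℝ), (0 : Fin n → ℝ)) +
    ∑ s, (ψ A * b s (idx1 m j) ⟨0, h0⟩ +
        (1 / 2) * ∑ l, A.1 l * b s (idx1 m j) (idx1 m l)) *
      fderiv ℝ ψ A ((0 : Fin (m - 1) → ℝ), (Pi.single s 1 : Fin n → ℝ))

/-- Euclidean norm on `ℝ^d × ℝ^e`. -/
def enormP {d e : ℕ} (P : (Fin d → ℝ) × (Fin e → ℝ)) : ℝ :=
  Real.sqrt (∑ i, (P.1 i) ^ 2 + ∑ s, (P.2 s) ^ 2)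

/-- Closed Euclidean ball in `ℝ^d × ℝ^e`. -/
def cballE {d e : ℕ} (A : (Fin d → ℝ) × (Fin e → ℝ)) (r : ℝ) :
    Set ((Fin d → ℝ) × (Fin e → ℝ)) :=
  {B | enormP (B - A) ≤ r}

/-- `ψ` is a broad* solution of `(D₂^ψψ,…,D_m^ψψ) = w` in `𝒪`: around every point
there are exponential maps of the vector fields `D_j^ψ` along which `ψ(γ(t)) − ψ(γ(0))`
is the integral of `w_j ∘ γ`. -/
def IsBroadStar (m n : ℕ) (h0 : 0 < m) (b : Fin n → Matrix (Fin m) (Fin m) ℝ)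
    (O : Set (W m n 1)) (ψ : W m n 1 → ℝ) (w : W m n 1 → Fin (m - 1) → ℝ) : Prop :=
  ∀ A ∈ O, ∃ δ₁ δ₂ : ℝ, 0 < δ₂ ∧ δ₂ < δ₁ ∧ cballE A δ₁ ⊆ O ∧
    ∀ j : Fin (m - 1), ∃ γ : ℝ → W m n 1 → W m n 1,
      ∀ B ∈ cballE A δ₂,
        (∀ t ∈ Set.Icc (-δ₂) δ₂, γ t B ∈ cballE A δ₁) ∧
        γ 0 B = B ∧
        (∀ h : Fin (m - 1), ∀ t ∈ Set.Icc (-δ₂) δ₂,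
          HasDerivAt (fun t' => (γ t' B).1 h) (if h = j then 1 else 0) t) ∧
        (∀ s : Fin n, ∀ t ∈ Set.Icc (-δ₂) δ₂,
          HasDerivAt (fun t' => (γ t' B).2 s)
            (ψ (γ t B) * b s (idx1 m j) ⟨0, h0⟩ +
              (1 / 2) * ∑ l, (γ t B).1 l * b s (idx1 m j) (idx1 m l)) t) ∧
        (∀ t ∈ Set.Icc (-δ₂) δ₂, ψ (γ t B) - ψ B = ∫ r in (0:ℝ)..t, w (γ r B) j)

/-! ### Weak form of a scalar equation along affine shears -/

lemma isOpen_superlevel {T : Type*} [TopologicalSpace T] {O : Set T} (hO : IsOpen O) {ψ : T → ℝ}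
    (hψ : ContinuousOn ψ O) : IsOpen {z : ℝ × T | z.2 ∈ O ∧ ψ z.2 < z.1} := by
  rw [isOpen_iff_mem_nhds]
  rintro z ⟨hz, hlt⟩
  have h1 : ContinuousAt (fun z : ℝ × T => ψ z.2) z :=
    ContinuousAt.comp (g := ψ) (hψ.continuousAt (hO.mem_nhds hz)) continuousAt_snd
  filter_upwards [continuousAt_snd.eventually_mem (hO.mem_nhds hz),
    h1.eventually_lt continuousAt_fst hlt] with y hy hy' using ⟨hy, hy'⟩

lemma integrable_mul_of_tsupport_subset {T : Type*} [TopologicalSpace T] [T2Space T]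
    [MeasureSpace T] [OpensMeasurableSpace T] [IsFiniteMeasureOnCompacts (volume : Measure T)]
    {O : Set T} {w η : T → ℝ}
    (hw : ContinuousOn w O) (hη : Continuous η) (hc : HasCompactSupport η) (hs : tsupport η ⊆ O) :
    Integrable fun A => w A * η A := by
  have h1 : IntegrableOn (fun A => w A * η A) (tsupport η) :=
    ((hw.mono hs).mul hη.continuousOn).integrableOn_compact hc
  refine (integrableOn_iff_integrable_of_support_subset fun A hA => ?_).1 h1
  exact subset_tsupport _ (right_ne_zero_of_mul hA)

section Shear

variable {X Y : Type*} [NormedAddCommGroup X] [NormedSpace ℝ X] [NormedAddCommGroup Y]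
  [NormedSpace ℝ Y]

/-- The time-`h` flow of the vector field `(x, y) ↦ (e, t • p + ℓ x)` (when `ℓ e = 0`). -/
def shear (e : X) (p : Y) (ℓ : X →L[ℝ] Y) (h t : ℝ) (A : X × Y) : X × Y :=
  A + h • (e, t • p + ℓ A.1)

lemma shear_zero (e : X) (p : Y) (ℓ : X →L[ℝ] Y) (t : ℝ) (A : X × Y) :
    shear e p ℓ 0 t A = A := by
  simp [shear]

lemma shear_neg_shear (e : X) (p : Y) (ℓ : X →L[ℝ] Y) (he : ℓ e = 0) (h t : ℝ) (A : X × Y) :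
    shear e p ℓ (-h) t (shear e p ℓ h t A) = A := by
  ext
  · simp [shear]
  · simp only [shear, Prod.snd_add, Prod.smul_snd, Prod.fst_add, Prod.smul_fst, map_add, map_smul,
      he]
    module

lemma shear_shear_neg (e : X) (p : Y) (ℓ : X →L[ℝ] Y) (he : ℓ e = 0) (h t : ℝ) (A : X × Y) :
    shear e p ℓ h t (shear e p ℓ (-h) t A) = A := by
  simpa using shear_neg_shear e p ℓ he (-h) t A

@[fun_prop]
lemma continuous_shear {T : Type*} [TopologicalSpace T] (e : X) (p : Y) (ℓ : X →L[ℝ] Y)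
    {h t : T → ℝ} {A : T → X × Y} (hh : Continuous h) (ht : Continuous t) (hA : Continuous A) :
    Continuous fun z => shear e p ℓ (h z) (t z) (A z) := by
  unfold shear
  fun_prop

/-- The measure of a superlevel set of an increment close to `t ↦ t - c`. -/
lemma abs_volume_real_sub_le {M c ρ : ℝ} {g : ℝ → ℝ} (hρ : 0 ≤ ρ) (hlo : -M ≤ c - ρ)
    (hhi : c + ρ ≤ M) (h1 : ∀ t ∈ Icc (-M) M, c + ρ < t → g t < t)
    (h2 : ∀ t ∈ Icc (-M) M, t ≤ c - ρ → t ≤ g t) :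
    |volume.real (Icc (-M) M ∩ {t | g t < t}) - (M - c)| ≤ ρ := by
  have hfin : volume (Icc (-M) M ∩ {t | g t < t}) ≠ ⊤ :=
    ((measure_mono inter_subset_left).trans_lt measure_Icc_lt_top).ne
  have hl : M - (c + ρ) ≤ volume.real (Icc (-M) M ∩ {t | g t < t}) := by
    rw [← Real.volume_real_Ioc_of_le hhi]
    refine measureReal_mono (fun t ht => ?_) hfin
    have : t ∈ Icc (-M) M := ⟨by linarith [ht.1], ht.2⟩
    exact ⟨this, h1 t this ht.1⟩
  have hu : volume.real (Icc (-M) M ∩ {t | g t < t}) ≤ M - (c - ρ) := by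
    rw [← Real.volume_real_Icc_of_le (show c - ρ ≤ M by linarith)]
    refine measureReal_mono (fun t ht => ⟨?_, ht.1.2⟩) measure_Icc_lt_top.ne
    by_contra! hlt
    exact absurd ht.2 (not_lt.2 (h2 t ht.1 hlt.le))
  rw [abs_le]
  constructor <;> linarith

/-- Local expansion, in the flow time, of the length of the set of levels lying above `ψ`. -/
lemma eventually_abs_volume_real_shear_le {O : Set (X × Y)} (hO : IsOpen O) {ψ w : X × Y → ℝ}
    (hψ : ContinuousOn ψ O) (hw : ContinuousOn w O) (e : X) (p : Y) (ℓ : X →L[ℝ] Y) {M : ℝ}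
    {A₀ : X × Y} (hA₀ : A₀ ∈ O) (hM : |ψ A₀| < M)
    (H : ∀ ε > 0, ∀ᶠ q : ℝ × (X × Y) in 𝓝 (0, A₀), ∀ t ∈ Icc (-M) M,
      |ψ (shear e p ℓ q.1 t q.2) - ψ q.2 - q.1 * w q.2| ≤ ε * (|q.1| + |t - ψ q.2|))
    {ε : ℝ} (hε : 0 < ε) :
    ∀ᶠ q : ℝ × (X × Y) in 𝓝 (0, A₀),
      |volume.real (Icc (-M) M ∩ {t | shear e p ℓ q.1 t q.2 ∈ O ∧ ψ (shear e p ℓ q.1 t q.2) < t})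
        - (M - ψ q.2) + q.1 * w q.2| ≤ ε * |q.1| := by
  have hψ0 : ContinuousAt ψ A₀ := hψ.continuousAt (hO.mem_nhds hA₀)
  have hw0 : ContinuousAt w A₀ := hw.continuousAt (hO.mem_nhds hA₀)
  have hψ1 : ContinuousAt (fun q : ℝ × (X × Y) => ψ q.2) (0, A₀) :=
    ContinuousAt.comp (x := ((0 : ℝ), A₀)) (g := ψ) hψ0 continuousAt_snd
  have hw1 : ContinuousAt (fun q : ℝ × (X × Y) => w q.2) (0, A₀) :=
    ContinuousAt.comp (x := ((0 : ℝ), A₀)) (g := w) hw0 continuousAt_snd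
  set R : ℝ := |w A₀| + 1 with hR
  have hRpos : 0 < 1 + R := by positivity
  set δ : ℝ := min (1 / 2) (ε / (2 * (1 + R))) with hδ
  have hδpos : 0 < δ := by positivity
  have hδ2 : δ ≤ 1 / 2 := min_le_left _ _
  have hδε : 2 * δ * (1 + R) ≤ ε := by
    have : δ ≤ ε / (2 * (1 + R)) := min_le_right _ _
    rw [le_div_iff₀ (by positivity)] at this
    linarith
  have ew : ∀ᶠ q : ℝ × (X × Y) in 𝓝 (0, A₀), |w q.2| < R :=
    hw1.abs.eventually_lt continuousAt_const (by simp [hR])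
  have hrho : ContinuousAt (fun q : ℝ × (X × Y) => 2 * δ * (1 + R) * |q.1|) (0, A₀) := by
    fun_prop
  have hmul : ContinuousAt (fun q : ℝ × (X × Y) => q.1 * w q.2) (0, A₀) :=
    continuousAt_fst.mul hw1
  have elo : ∀ᶠ q : ℝ × (X × Y) in 𝓝 (0, A₀),
      -M < ψ q.2 + q.1 * w q.2 - 2 * δ * (1 + R) * |q.1| :=
    continuousAt_const.eventually_lt ((hψ1.add hmul).sub hrho) (by simp; linarith [abs_lt.1 hM])
  have ehi : ∀ᶠ q : ℝ × (X × Y) in 𝓝 (0, A₀),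
      ψ q.2 + q.1 * w q.2 + 2 * δ * (1 + R) * |q.1| < M :=
    ((hψ1.add hmul).add hrho).eventually_lt continuousAt_const (by simp; linarith [abs_lt.1 hM])
  have eO : ∀ᶠ q : ℝ × (X × Y) in 𝓝 (0, A₀), ∀ t ∈ Icc (-M) M, shear e p ℓ q.1 t q.2 ∈ O := by
    refine isCompact_Icc.eventually_forall_of_forall_eventually fun t _ => ?_
    have hc : Continuous fun z : (ℝ × (X × Y)) × ℝ => shear e p ℓ z.1.1 z.2 z.1.2 := by fun_prop
    refine hc.continuousAt.eventually_mem (hO.mem_nhds ?_)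
    simpa [shear_zero] using hA₀
  filter_upwards [ew, elo, ehi, eO, H δ hδpos] with q hqw hlo hhi hqO hq
  have key : ∀ t ∈ Icc (-M) M, |ψ (shear e p ℓ q.1 t q.2) - (ψ q.2 + q.1 * w q.2)| ≤
      δ * (1 + R) * |q.1| + δ * |t - (ψ q.2 + q.1 * w q.2)| := by
    intro t ht
    have h1 := hq t ht
    have h2 : |t - ψ q.2| ≤ |t - (ψ q.2 + q.1 * w q.2)| + |q.1| * R := by
      calc |t - ψ q.2| = |(t - (ψ q.2 + q.1 * w q.2)) + q.1 * w q.2| := by ring_nf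
        _ ≤ |t - (ψ q.2 + q.1 * w q.2)| + |q.1 * w q.2| := abs_add_le _ _
        _ ≤ _ := by rw [abs_mul]; gcongr
    calc _ = |ψ (shear e p ℓ q.1 t q.2) - ψ q.2 - q.1 * w q.2| := by ring_nf
      _ ≤ δ * (|q.1| + |t - ψ q.2|) := h1
      _ ≤ δ * (|q.1| + (|t - (ψ q.2 + q.1 * w q.2)| + |q.1| * R)) := by gcongr
      _ = _ := by ring
  have hset : Icc (-M) M ∩ {t | shear e p ℓ q.1 t q.2 ∈ O ∧ ψ (shear e p ℓ q.1 t q.2) < t} =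
      Icc (-M) M ∩ {t | ψ (shear e p ℓ q.1 t q.2) < t} := by
    ext t
    simp only [mem_inter_iff, mem_ofPred_eq]
    exact ⟨fun h => ⟨h.1, h.2.2⟩, fun h => ⟨h.1, hqO t h.1, h.2⟩⟩
  rw [hset]
  have hfinal := abs_volume_real_sub_le (M := M) (c := ψ q.2 + q.1 * w q.2)
    (ρ := 2 * δ * (1 + R) * |q.1|) (g := fun t => ψ (shear e p ℓ q.1 t q.2)) (by positivity)
    hlo.le hhi.le ?_ ?_
  · calc _ = |volume.real (Icc (-M) M ∩ {t | ψ (shear e p ℓ q.1 t q.2) < t})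
          - (M - (ψ q.2 + q.1 * w q.2))| := by ring_nf
      _ ≤ _ := hfinal
      _ ≤ _ := by gcongr
  · intro t ht hlt
    have hk := key t ht
    have h0 : 0 ≤ 2 * δ * (1 + R) * |q.1| := by positivity
    rw [abs_of_pos (show 0 < t - (ψ q.2 + q.1 * w q.2) by linarith)] at hk
    have := (abs_le.1 hk).2
    nlinarith
  · intro t ht hlt
    have hk := key t ht
    have h0 : 0 ≤ 2 * δ * (1 + R) * |q.1| := by positivity
    rw [abs_of_nonpos (show t - (ψ q.2 + q.1 * w q.2) ≤ 0 by linarith)] at hk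
    have := (abs_le.1 hk).1
    nlinarith

variable [FiniteDimensional ℝ X] [MeasureSpace X] [BorelSpace X]
  [(volume : Measure X).IsAddHaarMeasure] [FiniteDimensional ℝ Y] [MeasureSpace Y] [BorelSpace Y]
  [(volume : Measure Y).IsAddHaarMeasure]

lemma measurePreserving_shear (e : X) (p : Y) (ℓ : X →L[ℝ] Y) (h t : ℝ) :
    MeasurePreserving (shear e p ℓ h t) volume volume := by
  have := MeasurePreserving.skew_product (μc := (volume : Measure Y)) (μd := volume)
    (measurePreserving_add_right (volume : Measure X) (h • e))
    (g := fun x y => y + h • (t • p + ℓ x)) (by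
      have : Continuous (Function.uncurry fun (x : X) (y : Y) => y + h • (t • p + ℓ x)) := by
        simp only [Function.uncurry_def]; fun_prop
      exact this.measurable)
    (ae_of_all _ fun x => (measurePreserving_add_right (volume : Measure Y) _).map_eq)
  exact this

lemma measurePreserving_prodMk_shear (ν : Measure ℝ) [SFinite ν] (e : X) (p : Y) (ℓ : X →L[ℝ] Y)
    (h : ℝ) :
    MeasurePreserving (fun z : ℝ × (X × Y) => (z.1, shear e p ℓ h z.1 z.2))
      (ν.prod volume) (ν.prod volume) := by
  refine (MeasurePreserving.id ν).skew_product (g := fun t => shear e p ℓ h t) ?_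
    (ae_of_all _ fun t => (measurePreserving_shear e p ℓ h t).map_eq)
  have : Continuous (Function.uncurry fun (t : ℝ) (A : X × Y) => shear e p ℓ h t A) := by
    simp only [Function.uncurry_def]; fun_prop
  exact this.measurable

/-- Change of variables moving the flow from the set `S` to the function `η`. -/
lemma integral_mul_indicator_shear (ν : Measure ℝ) [SFinite ν] (e : X) (p : Y) (ℓ : X →L[ℝ] Y)
    (he : ℓ e = 0) {S : Set (ℝ × (X × Y))} (hS : MeasurableSet S) {η : X × Y → ℝ}
    (hη : Continuous η) (h : ℝ) :
    ∫ z, η z.2 * S.indicator 1 (z.1, shear e p ℓ h z.1 z.2) ∂(ν.prod volume) =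
      ∫ z, η (shear e p ℓ (-h) z.1 z.2) * S.indicator 1 z ∂(ν.prod volume) := by
  have hmp := measurePreserving_prodMk_shear ν e p ℓ h
  have hmeas : Measurable fun z : ℝ × (X × Y) =>
      η (shear e p ℓ (-h) z.1 z.2) * S.indicator (1 : ℝ × (X × Y) → ℝ) z := by
    have : Continuous fun z : ℝ × (X × Y) => η (shear e p ℓ (-h) z.1 z.2) := by fun_prop
    exact this.measurable.mul (measurable_one.indicator hS)
  conv_rhs => rw [← hmp.map_eq]
  rw [integral_map hmp.measurable.aemeasurable hmeas.aestronglyMeasurable]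
  simp only [shear_neg_shear e p ℓ he]

/-- Differentiation under the integral along the shear flow. -/
lemma hasDerivAt_integral_shear (e : X) (p : Y) (ℓ : X →L[ℝ] Y) (he : ℓ e = 0) (M : ℝ)
    {S : Set (ℝ × (X × Y))} (hS : MeasurableSet S) {η : X × Y → ℝ}
    (hη : ContDiff ℝ 1 η) (hc : HasCompactSupport η) :
    Integrable (fun z => fderiv ℝ η z.2 (e, z.1 • p + ℓ z.2.1) *
      S.indicator (1 : ℝ × (X × Y) → ℝ) z)
        ((volume.restrict (Icc (-M) M)).prod volume) ∧
    HasDerivAt (fun h : ℝ => ∫ z, η (shear e p ℓ (-h) z.1 z.2) * S.indicator 1 z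
        ∂((volume.restrict (Icc (-M) M)).prod volume))
      (-∫ z, fderiv ℝ η z.2 (e, z.1 • p + ℓ z.2.1) * S.indicator 1 z
        ∂((volume.restrict (Icc (-M) M)).prod volume)) 0 := by
  set μ : Measure (ℝ × (X × Y)) := (volume.restrict (Icc (-M) M)).prod volume with hμ
  have hηc := hη.continuous
  have hdη : Continuous (fderiv ℝ η) := hη.continuous_fderiv one_ne_zero
  set D : ℝ → ℝ × (X × Y) → ℝ := fun h z =>
    -fderiv ℝ η (shear e p ℓ (-h) z.1 z.2) (e, z.1 • p + ℓ z.2.1) with hD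
  have hDc : Continuous fun q : ℝ × (ℝ × (X × Y)) => D q.1 q.2 := by
    simp only [hD]
    refine Continuous.neg (Continuous.clm_apply (hdη.comp ?_) ?_) <;> fun_prop
  -- compact set containing all the relevant supports
  set K : Set (X × Y) := (fun q : (ℝ × ℝ) × (X × Y) => shear e p ℓ q.1.1 q.1.2 q.2) ''
    ((Icc (-1) 1 ×ˢ Icc (-M) M) ×ˢ tsupport η) with hK
  have hKc : IsCompact K :=
    ((isCompact_Icc.prod isCompact_Icc).prod hc).image (by fun_prop)
  have hmemK : ∀ h ∈ Icc (-1 : ℝ) 1, ∀ t ∈ Icc (-M) M, ∀ A, shear e p ℓ (-h) t A ∈ tsupport η →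
      A ∈ K := fun h hh t ht A hA =>
    ⟨((h, t), shear e p ℓ (-h) t A), ⟨⟨hh, ht⟩, hA⟩, shear_shear_neg e p ℓ he h t A⟩
  obtain ⟨C, hC⟩ := (isCompact_Icc.prod (isCompact_Icc.prod hKc)).exists_bound_of_continuousOn
    (s := Icc (-1 : ℝ) 1 ×ˢ (Icc (-M) M ×ˢ K)) hDc.continuousOn
  have hae : ∀ᵐ z ∂μ, z.1 ∈ Icc (-M) M := by
    have : ∀ᵐ t ∂(volume.restrict (Icc (-M) M)), t ∈ Icc (-M) M := ae_restrict_mem measurableSet_Icc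
    exact Measure.quasiMeasurePreserving_fst.ae this
  have hKmeas : MeasurableSet (Icc (-M) M ×ˢ K) := measurableSet_Icc.prod hKc.measurableSet
  have hKfin : μ (Icc (-M) M ×ˢ K) < ⊤ := by
    rw [hμ, Measure.prod_prod]
    exact ENNReal.mul_lt_top (by simp) hKc.measure_lt_top
  have hind : Measurable (S.indicator (1 : ℝ × (X × Y) → ℝ)) := measurable_one.indicator hS
  have hindle : ∀ z, ‖S.indicator (1 : ℝ × (X × Y) → ℝ) z‖ ≤ 1 := fun z => by
    by_cases hz : z ∈ S <;> simp [hz]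
  have hF : ∀ h : ℝ, Continuous fun z : ℝ × (X × Y) => η (shear e p ℓ (-h) z.1 z.2) := fun h => by
    fun_prop
  obtain ⟨C', hC'⟩ := hc.exists_bound_of_continuous hηc
  have hmain := hasDerivAt_integral_of_dominated_loc_of_deriv_le (μ := μ) (x₀ := (0 : ℝ))
    (s := Icc (-1) 1)
    (F := fun h z => η (shear e p ℓ (-h) z.1 z.2) * S.indicator 1 z)
    (F' := fun h z => D h z * S.indicator 1 z)
    (bound := (Icc (-M) M ×ˢ K).indicator fun _ => C)
    (Icc_mem_nhds (by norm_num) (by norm_num))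
    (Eventually.of_forall fun h => ((hF h).measurable.mul hind).aestronglyMeasurable)
    ?_ ?_ ?_ ?_ ?_
  · refine ⟨?_, ?_⟩
    · refine hmain.1.neg.congr (ae_of_all _ fun z => ?_)
      simp [hD, shear_zero]
    · have hval : -∫ z, fderiv ℝ η z.2 (e, z.1 • p + ℓ z.2.1) * S.indicator 1 z ∂μ =
          ∫ z, D 0 z * S.indicator 1 z ∂μ := by
        rw [← integral_neg]
        simp [hD, shear_zero]
      rw [hval]
      exact hmain.2
  · refine Integrable.mono' (g := (Icc (-M) M ×ˢ K).indicator fun _ => C')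
      ((integrable_indicator_iff hKmeas).2 (integrableOn_const hKfin.ne))
      ((hF 0).measurable.mul hind).aestronglyMeasurable ?_
    filter_upwards [hae] with z hz
    by_cases hzK : z.2 ∈ K
    · rw [indicator_of_mem (show z ∈ Icc (-M) M ×ˢ K from ⟨hz, hzK⟩), norm_mul]
      calc _ ≤ C' * 1 := mul_le_mul (hC' _) (hindle z) (norm_nonneg _)
            ((norm_nonneg _).trans (hC' z.2))
        _ = C' := mul_one _
    · have : shear e p ℓ (-0) z.1 z.2 ∉ tsupport η := fun h =>
        hzK (hmemK 0 (by simp) z.1 hz z.2 h)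
      rw [image_eq_zero_of_notMem_tsupport this,
        indicator_of_notMem (show z ∉ Icc (-M) M ×ˢ K from fun h => hzK h.2)]
      simp
  · have : Continuous (D 0) := hDc.comp (Continuous.prodMk_right 0)
    exact (this.measurable.mul hind).aestronglyMeasurable
  · filter_upwards [hae] with z hz h hh
    by_cases hzK : z.2 ∈ K
    · have hb : ‖D h z‖ ≤ C := hC (h, z) ⟨hh, hz, hzK⟩
      rw [indicator_of_mem (show z ∈ Icc (-M) M ×ˢ K from ⟨hz, hzK⟩), norm_mul]
      calc _ ≤ C * 1 := mul_le_mul hb (hindle z) (norm_nonneg _) ((norm_nonneg _).trans hb)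
        _ = C := mul_one _
    · have : shear e p ℓ (-h) z.1 z.2 ∉ tsupport (fderiv ℝ η) := fun h' =>
        hzK (hmemK h hh z.1 hz z.2 (tsupport_fderiv_subset ℝ h'))
      rw [indicator_of_notMem (show z ∉ Icc (-M) M ×ˢ K from fun h => hzK h.2)]
      simp [hD, image_eq_zero_of_notMem_tsupport this]
  · exact (integrable_indicator_iff hKmeas).2 (integrableOn_const hKfin.ne)
  · refine ae_of_all _ fun z h _ => HasDerivAt.mul_const ?_ _
    have h1 : HasDerivAt (fun h : ℝ => shear e p ℓ (-h) z.1 z.2) (-(e, z.1 • p + ℓ z.2.1)) h := by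
      unfold shear
      simpa only [neg_smul, one_smul] using
        ((hasDerivAt_neg h).smul_const (e, z.1 • p + ℓ z.2.1)).const_add z.2
    have h2 := ((hη.differentiable one_ne_zero) (shear e p ℓ (-h) z.1 z.2)).hasFDerivAt
    simp only [hD, ← map_neg]
    exact h2.comp_hasDerivAt h h1

lemma hasDerivAt_integral_superlevel {O : Set (X × Y)} (hO : IsOpen O) {ψ w : X × Y → ℝ}
    (hψ : ContinuousOn ψ O) (hw : ContinuousOn w O) (e : X) (p : Y) (ℓ : X →L[ℝ] Y) {M : ℝ}
    {η : X × Y → ℝ} (hη : Continuous η) (hc : HasCompactSupport η) (hs : tsupport η ⊆ O)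
    (hM : ∀ A ∈ tsupport η, |ψ A| < M)
    (H : ∀ A₀ ∈ O, ∀ ε > 0, ∀ᶠ q : ℝ × (X × Y) in 𝓝 (0, A₀), ∀ t ∈ Icc (-M) M,
      |ψ (shear e p ℓ q.1 t q.2) - ψ q.2 - q.1 * w q.2| ≤ ε * (|q.1| + |t - ψ q.2|)) :
    HasDerivAt (fun h : ℝ => ∫ z, η z.2 * {z : ℝ × (X × Y) | z.2 ∈ O ∧ ψ z.2 < z.1}.indicator 1
        (z.1, shear e p ℓ h z.1 z.2) ∂((volume.restrict (Icc (-M) M)).prod volume))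
      (-∫ A in O, w A * η A) 0 := by
  set S : Set (ℝ × (X × Y)) := {z | z.2 ∈ O ∧ ψ z.2 < z.1} with hS
  have hSm : MeasurableSet S := (isOpen_superlevel hO hψ).measurableSet
  set V : ℝ → X × Y → ℝ := fun h A => volume.real
    (Icc (-M) M ∩ {t | shear e p ℓ h t A ∈ O ∧ ψ (shear e p ℓ h t A) < t}) with hV
  have hηi : Integrable η := hη.integrable_of_hasCompactSupport hc
  have hind : Measurable (S.indicator (1 : ℝ × (X × Y) → ℝ)) := measurable_one.indicator hSm
  have hmap : ∀ h : ℝ, Measurable fun z : ℝ × (X × Y) => (z.1, shear e p ℓ h z.1 z.2) := fun h =>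
    (show Continuous fun z : ℝ × (X × Y) => (z.1, shear e p ℓ h z.1 z.2) by fun_prop).measurable
  have hinteg : ∀ h : ℝ, Integrable (fun z : ℝ × (X × Y) =>
      η z.2 * S.indicator 1 (z.1, shear e p ℓ h z.1 z.2))
      ((volume.restrict (Icc (-M) M)).prod volume) := fun h => by
    refine Integrable.mono' (hηi.norm.comp_snd _)
      ((hη.measurable.comp measurable_snd).mul (hind.comp (hmap h))).aestronglyMeasurable
      (ae_of_all _ fun z => ?_)
    by_cases hz : (z.1, shear e p ℓ h z.1 z.2) ∈ S <;> simp [hz]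
  have hsect : ∀ h A, ∫ t in Icc (-M) M, η A * S.indicator 1 (t, shear e p ℓ h t A) =
      η A * V h A := fun h A => by
    rw [integral_const_mul]
    congr 1
    have hm : MeasurableSet {t | shear e p ℓ h t A ∈ O ∧ ψ (shear e p ℓ h t A) < t} :=
      ((hmap h).comp (measurable_id.prodMk measurable_const)) hSm
    simp only [hV]
    rw [inter_comm, ← measureReal_restrict_apply hm, ← integral_indicator_one hm]
    rfl
  have hJ : ∀ h, ∫ z, η z.2 * S.indicator 1 (z.1, shear e p ℓ h z.1 z.2)
      ∂((volume.restrict (Icc (-M) M)).prod volume) = ∫ A, η A * V h A := fun h => by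
    rw [integral_prod_symm _ (hinteg h)]
    simp only [hsect]
  have hVi : ∀ h, Integrable fun A => η A * V h A := fun h => by
    simpa only [hsect] using (hinteg h).integral_prod_right
  have hwi := integrable_mul_of_tsupport_subset hw hη hc hs
  have hE : ∀ ε > 0, ∀ᶠ h in 𝓝 (0 : ℝ), ∀ A ∈ tsupport η,
      |V h A - (M - ψ A) + h * w A| ≤ ε * |h| := fun ε hε =>
    hc.isCompact.eventually_forall_of_forall_eventually fun A₀ hA₀ =>
      eventually_abs_volume_real_shear_le hO hψ hw e p ℓ (hs hA₀) (hM A₀ hA₀) (H A₀ (hs hA₀)) hε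
  have hV0 : ∀ A ∈ tsupport η, V 0 A = M - ψ A := fun A hA => by
    have := (hE 1 one_pos).self_of_nhds A hA
    simp only [zero_mul, add_zero, abs_zero, mul_zero, abs_nonpos_iff] at this
    linarith
  have hwO : ∫ A in O, w A * η A = ∫ A, w A * η A :=
    setIntegral_eq_integral_of_forall_compl_eq_zero fun A hA => by
      rw [image_eq_zero_of_notMem_tsupport fun h => hA (hs h), mul_zero]
  simp only [hJ, hwO]
  rw [hasDerivAt_iff_isLittleO, Asymptotics.isLittleO_iff]
  intro ε hε
  have hI : 0 ≤ ∫ A, |η A| := integral_nonneg fun _ => abs_nonneg _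
  filter_upwards [hE (ε / (1 + ∫ A, |η A|)) (by positivity)] with h hh
  have heq : (∫ A, η A * V h A) - (∫ A, η A * V 0 A) - (h - 0) • (-∫ A, w A * η A) =
      ∫ A, (η A * V h A - η A * V 0 A + h * (w A * η A)) := by
    have h1 : Integrable fun A => η A * V h A - η A * V 0 A := (hVi h).sub (hVi 0)
    rw [integral_add h1 (hwi.const_mul h), integral_sub (hVi h) (hVi 0), integral_const_mul]
    simp
  rw [heq]
  calc ‖∫ A, (η A * V h A - η A * V 0 A + h * (w A * η A))‖
      ≤ ∫ A, ε / (1 + ∫ A, |η A|) * |h| * |η A| := by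
        refine norm_integral_le_of_norm_le (hηi.abs.const_mul _) (ae_of_all _ fun A => ?_)
        by_cases hA : A ∈ tsupport η
        · rw [hV0 A hA, show η A * V h A - η A * (M - ψ A) + h * (w A * η A) =
            (V h A - (M - ψ A) + h * w A) * η A by ring, norm_mul]
          exact mul_le_mul_of_nonneg_right (hh A hA) (norm_nonneg _)
        · simp [image_eq_zero_of_notMem_tsupport hA]
    _ = ε * |h| * ((∫ A, |η A|) / (1 + ∫ A, |η A|)) := by
        rw [integral_const_mul]; ring
    _ ≤ ε * |h| * 1 := by
        gcongr
        rw [div_le_one (by positivity)]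
        linarith
    _ = ε * ‖h - 0‖ := by simp

/-- Integration of the equation over the levels in `[ψ, M]`. -/
lemma integral_levels_eq {O : Set (X × Y)} (hO : IsOpen O) {ψ w : X × Y → ℝ}
    (hψ : ContinuousOn ψ O) (hw : ContinuousOn w O) (e : X) (p : Y) (ℓ : X →L[ℝ] Y)
    (he : ℓ e = 0) {M : ℝ}
    {η : X × Y → ℝ} (hη : ContDiff ℝ 1 η) (hc : HasCompactSupport η) (hs : tsupport η ⊆ O)
    (hM : ∀ A ∈ tsupport η, |ψ A| < M)
    (H : ∀ A₀ ∈ O, ∀ ε > 0, ∀ᶠ q : ℝ × (X × Y) in 𝓝 (0, A₀), ∀ t ∈ Icc (-M) M,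
      |ψ (shear e p ℓ q.1 t q.2) - ψ q.2 - q.1 * w q.2| ≤ ε * (|q.1| + |t - ψ q.2|)) :
    ∫ A, ((M - ψ A) * (fderiv ℝ η A (e, 0) + fderiv ℝ η A (0, ℓ A.1)) +
      (M ^ 2 - ψ A ^ 2) / 2 * fderiv ℝ η A (0, p)) = ∫ A in O, w A * η A := by
  set S : Set (ℝ × (X × Y)) := {z | z.2 ∈ O ∧ ψ z.2 < z.1} with hS
  have hSm : MeasurableSet S := (isOpen_superlevel hO hψ).measurableSet
  obtain ⟨hi, h1⟩ := hasDerivAt_integral_shear e p ℓ he M hSm hη hc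
  have h2 := hasDerivAt_integral_superlevel hO hψ hw e p ℓ hη.continuous hc hs hM H
  simp only [← hS, integral_mul_indicator_shear _ e p ℓ he hSm hη.continuous] at h2
  rw [← neg_injective (h1.unique h2), integral_prod_symm _ hi]
  congr 1
  ext A
  by_cases hA : A ∈ tsupport η
  · have hMA := abs_lt.1 (hM A hA)
    have hsec : ∀ t, fderiv ℝ η A (e, t • p + ℓ A.1) * S.indicator (1 : ℝ × (X × Y) → ℝ) (t, A) =
        (Ioi (ψ A)).indicator (fun t => fderiv ℝ η A (e, 0) + fderiv ℝ η A (0, ℓ A.1) +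
          t * fderiv ℝ η A (0, p)) t := fun t => by
      have hd : fderiv ℝ η A (e, t • p + ℓ A.1) =
          fderiv ℝ η A (e, 0) + fderiv ℝ η A (0, ℓ A.1) + t * fderiv ℝ η A (0, p) := by
        rw [← smul_eq_mul, ← map_smul, ← map_add, ← map_add]
        congr 1
        ext <;> simp [add_comm]
      by_cases ht : ψ A < t
      · rw [indicator_of_mem (show (t, A) ∈ S from ⟨hs hA, ht⟩),
          indicator_of_mem (show t ∈ Ioi (ψ A) from ht), hd]
        simp
      · rw [indicator_of_notMem (show (t, A) ∉ S from fun h => ht h.2),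
          indicator_of_notMem (show t ∉ Ioi (ψ A) from ht), mul_zero]
    simp only [hsec]
    rw [setIntegral_indicator measurableSet_Ioi,
      show Icc (-M) M ∩ Ioi (ψ A) = Ioc (ψ A) M by
        ext t
        simp only [mem_inter_iff, mem_Icc, mem_Ioi, mem_Ioc]
        exact ⟨fun h => ⟨h.2, h.1.2⟩, fun h => ⟨⟨by linarith [h.1], h.2⟩, h.1⟩⟩,
      ← intervalIntegral.integral_of_le hMA.2.le, intervalIntegral.integral_add (by simp)
        (by apply Continuous.intervalIntegrable; fun_prop), intervalIntegral.integral_const,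
      intervalIntegral.integral_mul_const, integral_id, smul_eq_mul]
  · have : fderiv ℝ η A = 0 :=
      image_eq_zero_of_notMem_tsupport fun h => hA (tsupport_fderiv_subset ℝ h)
    simp [this]

/-- If the increments of `ψ` along the shear flow at level `t` are `h * w` up to an error
`o(|h| + |t - ψ|)`, then `∂_e ψ + (ψ p + ℓ x) · ∂_y ψ = w` in the sense of distributions. -/
theorem integral_weak_form {O : Set (X × Y)} (hO : IsOpen O) {ψ w : X × Y → ℝ}
    (hψ : ContinuousOn ψ O) (hw : ContinuousOn w O) (e : X) (p : Y) (ℓ : X →L[ℝ] Y)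
    (he : ℓ e = 0)
    (H : ∀ M : ℝ, ∀ A₀ ∈ O, ∀ ε > 0, ∀ᶠ q : ℝ × (X × Y) in 𝓝 (0, A₀), ∀ t ∈ Icc (-M) M,
      |ψ (shear e p ℓ q.1 t q.2) - ψ q.2 - q.1 * w q.2| ≤ ε * (|q.1| + |t - ψ q.2|))
    {η : X × Y → ℝ} (hη : ContDiff ℝ 1 η) (hc : HasCompactSupport η) (hs : tsupport η ⊆ O) :
    ∫ A in O, (ψ A * (fderiv ℝ η A (e, 0) + fderiv ℝ η A (0, ℓ A.1)) +
      ψ A ^ 2 / 2 * fderiv ℝ η A (0, p)) = -∫ A in O, w A * η A := by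
  obtain ⟨C, hC⟩ := hc.isCompact.exists_bound_of_continuousOn (hψ.mono hs)
  have hM : ∀ A ∈ tsupport η, |ψ A| < |C| + 1 := fun A hA =>
    (hC A hA).trans_lt ((le_abs_self C).trans_lt (lt_add_one _))
  have h1 := integral_levels_eq hO hψ hw e p ℓ he hη hc hs hM (H _)
  have h0 := integral_levels_eq (ψ := fun _ => 0) (w := fun _ => 0) (M := |C| + 1) isOpen_univ
    continuousOn_const continuousOn_const e p ℓ he hη hc (subset_univ _)
    (fun A _ => by rw [abs_zero]; positivity)
    (fun A₀ _ ε hε => Eventually.of_forall fun q t _ => by simp; positivity)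
  have hd0 : ∀ A ∉ tsupport η, fderiv ℝ η A = 0 := fun A hA =>
    image_eq_zero_of_notMem_tsupport fun h => hA (tsupport_fderiv_subset ℝ h)
  have hdη : Continuous (fderiv ℝ η) := hη.continuous_fderiv one_ne_zero
  have hinteg : ∀ φ : X × Y → ℝ, ContinuousOn φ O → Integrable fun A =>
      ((|C| + 1 - φ A) * (fderiv ℝ η A (e, 0) + fderiv ℝ η A (0, ℓ A.1)) +
      ((|C| + 1) ^ 2 - φ A ^ 2) / 2 * fderiv ℝ η A (0, p)) := fun φ hφ => by
    have hcont : ContinuousOn (fun A =>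
        ((|C| + 1 - φ A) * (fderiv ℝ η A (e, 0) + fderiv ℝ η A (0, ℓ A.1)) +
        ((|C| + 1) ^ 2 - φ A ^ 2) / 2 * fderiv ℝ η A (0, p))) O := by
      have a1 : Continuous fun A : X × Y => fderiv ℝ η A (0, ℓ A.1) :=
        hdη.clm_apply (by fun_prop)
      have a2 : Continuous fun A : X × Y => fderiv ℝ η A (e, 0) := hdη.clm_apply (by fun_prop)
      have a3 : Continuous fun A : X × Y => fderiv ℝ η A (0, p) := hdη.clm_apply (by fun_prop)
      exact ((continuousOn_const.sub hφ).mul (a2.add a1).continuousOn).add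
        (((continuousOn_const.sub (hφ.pow 2)).div_const 2).mul a3.continuousOn)
    refine (integrableOn_iff_integrable_of_support_subset fun A hA => ?_).1
      ((hcont.mono hs).integrableOn_compact hc)
    by_contra hA'
    exact hA (by simp [hd0 A hA'])
  have hrw : ∫ A in O, (ψ A * (fderiv ℝ η A (e, 0) + fderiv ℝ η A (0, ℓ A.1)) +
      ψ A ^ 2 / 2 * fderiv ℝ η A (0, p)) =
      ∫ A, (ψ A * (fderiv ℝ η A (e, 0) + fderiv ℝ η A (0, ℓ A.1)) +
      ψ A ^ 2 / 2 * fderiv ℝ η A (0, p)) :=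
    setIntegral_eq_integral_of_forall_compl_eq_zero fun A hA => by
      simp [hd0 A fun h => hA (hs h)]
  have hsub := integral_sub (hinteg (fun _ => 0) continuousOn_const) (hinteg ψ hψ)
  rw [h1, h0] at hsub
  simp only [zero_mul, integral_zero, zero_sub] at hsub
  rw [hrw, ← hsub]
  congr 1
  ext A
  ring

end Shear

/-! ### The Euclidean norm and the quasi-norm -/

section Norms

variable {d : ℕ}

lemma enorm_eq_norm (x : Fin d → ℝ) : enorm x = ‖WithLp.toLp 2 x‖ := by
  simp [enorm, EuclideanSpace.norm_eq]

lemma enorm_nonneg (x : Fin d → ℝ) : 0 ≤ enorm x := Real.sqrt_nonneg _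

@[simp]
lemma enorm_zero : enorm (0 : Fin d → ℝ) = 0 := by simp [enorm]

lemma enorm_add_le (x y : Fin d → ℝ) : enorm (x + y) ≤ enorm x + enorm y := by
  simpa only [enorm_eq_norm, WithLp.toLp_add] using norm_add_le (WithLp.toLp 2 x) (WithLp.toLp 2 y)

lemma enorm_smul (c : ℝ) (x : Fin d → ℝ) : enorm (c • x) = |c| * enorm x := by
  simpa only [enorm_eq_norm, WithLp.toLp_smul, Real.norm_eq_abs] using norm_smul c (WithLp.toLp 2 x)

lemma abs_apply_le_enorm (x : Fin d → ℝ) (i : Fin d) : |x i| ≤ enorm x := by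
  simpa only [enorm_eq_norm, Real.norm_eq_abs] using PiLp.norm_apply_le (WithLp.toLp 2 x) i

lemma enorm_le_sum_abs (x : Fin d → ℝ) : enorm x ≤ ∑ i, |x i| := by
  refine Real.sqrt_le_iff.2 ⟨Finset.sum_nonneg fun _ _ => abs_nonneg _, ?_⟩
  simpa only [sq_abs] using
    Finset.sum_sq_le_sq_sum_of_nonneg (s := Finset.univ) fun i _ => abs_nonneg (x i)

lemma enorm_single (i : Fin d) (c : ℝ) : enorm (Pi.single i c) = |c| := by
  rw [enorm_eq_norm]
  simp

lemma norm_le_enorm (x : Fin d → ℝ) : ‖x‖ ≤ enorm x :=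
  (pi_norm_le_iff_of_nonneg (enorm_nonneg x)).2 fun i => abs_apply_le_enorm x i

@[fun_prop]
lemma continuous_enorm' : Continuous (enorm : (Fin d → ℝ) → ℝ) := by
  unfold enorm
  fun_prop

lemma abs_sum_mul_le (a x : Fin d → ℝ) : |∑ i, a i * x i| ≤ (∑ i, |a i|) * enorm x := by
  rw [Finset.sum_mul]
  refine (Finset.abs_sum_le_sum_abs _ _).trans (Finset.sum_le_sum fun i _ => ?_)
  rw [abs_mul]
  exact mul_le_mul_of_nonneg_left (abs_apply_le_enorm x i) (abs_nonneg _)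

variable {m n : ℕ}

lemma qnorm_nonneg (P : G m n) : 0 ≤ qnorm P := add_nonneg (enorm_nonneg _) (Real.sqrt_nonneg _)

lemma enorm_fst_le_qnorm (P : G m n) : enorm P.1 ≤ qnorm P :=
  le_add_of_nonneg_right (Real.sqrt_nonneg _)

lemma sqrt_enorm_snd_le_qnorm (P : G m n) : √(enorm P.2) ≤ qnorm P :=
  le_add_of_nonneg_left (enorm_nonneg _)

lemma exists_qnorm_lt_imp_mem {s : Set (G m n)} (hs : s ∈ 𝓝 (0 : G m n)) :
    ∃ r > 0, ∀ P, qnorm P < r → P ∈ s := by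
  obtain ⟨δ, hδ, hball⟩ := Metric.mem_nhds_iff.1 hs
  refine ⟨min δ √δ, by positivity, fun P hP => hball ?_⟩
  rw [Metric.mem_ball, dist_zero_right, Prod.norm_def, max_lt_iff]
  constructor
  · exact ((norm_le_enorm _).trans (enorm_fst_le_qnorm P)).trans_lt (hP.trans_le (min_le_left _ _))
  · refine (norm_le_enorm _).trans_lt ((Real.sqrt_lt_sqrt_iff (enorm_nonneg _)).1 ?_)
    exact (sqrt_enorm_snd_le_qnorm P).trans_lt (hP.trans_le (min_le_right _ _))

end Norms

/-! ### The group structure -/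

section Group

variable {m n : ℕ} (b : Fin n → Matrix (Fin m) (Fin m) ℝ)

/-- The bilinear map `(x, x') ↦ ⟨Bx, x'⟩`. -/
def bform (x x' : Fin m → ℝ) : Fin n → ℝ := fun s => ∑ i, ∑ j, b s i j * x j * x' i

lemma gmul_eq (P Q : G m n) : gmul b P Q =
    (P.1 + Q.1, P.2 + Q.2 + (1 / 2 : ℝ) • bform b P.1 Q.1) := by
  ext <;> simp [gmul, bform]

lemma bform_add_left (x y z : Fin m → ℝ) : bform b (x + y) z = bform b x z + bform b y z := by
  ext s
  simp only [bform, Pi.add_apply, mul_add, add_mul, Finset.sum_add_distrib]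

lemma bform_add_right (x y z : Fin m → ℝ) : bform b x (y + z) = bform b x y + bform b x z := by
  ext s
  simp only [bform, Pi.add_apply, mul_add, Finset.sum_add_distrib]

lemma bform_smul_left (c : ℝ) (x y : Fin m → ℝ) : bform b (c • x) y = c • bform b x y := by
  ext s
  simp only [bform, Pi.smul_apply, smul_eq_mul, Finset.mul_sum]
  refine Finset.sum_congr rfl fun i _ => Finset.sum_congr rfl fun j _ => by ring

lemma bform_smul_right (c : ℝ) (x y : Fin m → ℝ) : bform b x (c • y) = c • bform b x y := by
  ext s
  simp only [bform, Pi.smul_apply, smul_eq_mul, Finset.mul_sum]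
  refine Finset.sum_congr rfl fun i _ => Finset.sum_congr rfl fun j _ => by ring

lemma bform_neg_left (x y : Fin m → ℝ) : bform b (-x) y = -bform b x y := by
  simpa using bform_smul_left b (-1) x y

lemma bform_neg_right (x y : Fin m → ℝ) : bform b x (-y) = -bform b x y := by
  simpa using bform_smul_right b (-1) x y

@[simp]
lemma bform_zero_right (x : Fin m → ℝ) : bform b x 0 = 0 := by
  ext s; simp [bform]

lemma bform_single (i j : Fin m) : bform b (Pi.single j 1) (Pi.single i 1) = fun s => b s i j := by
  ext s
  simp [bform, Pi.single_apply]

variable {b}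

lemma bform_swap (hskew : ∀ s, (b s).transpose = -(b s)) (x y : Fin m → ℝ) :
    bform b x y = -bform b y x := by
  ext s
  simp only [bform, Pi.neg_apply, ← Finset.sum_neg_distrib]
  rw [Finset.sum_comm]
  refine Finset.sum_congr rfl fun i _ => Finset.sum_congr rfl fun j _ => ?_
  have := congr_fun (congr_fun (hskew s) i) j
  simp only [Matrix.transpose_apply, Matrix.neg_apply] at this
  rw [this]
  ring

lemma bform_self (hskew : ∀ s, (b s).transpose = -(b s)) (x : Fin m → ℝ) :
    bform b x x = 0 :=
  self_eq_neg.1 (bform_swap hskew x x)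

@[fun_prop]
lemma continuous_bform {T : Type*} [TopologicalSpace T] {u v : T → Fin m → ℝ}
    (hu : Continuous u) (hv : Continuous v) : Continuous fun t => bform b (u t) (v t) := by
  unfold bform
  fun_prop

@[fun_prop]
lemma continuous_gmul {T : Type*} [TopologicalSpace T] {u v : T → G m n}
    (hu : Continuous u) (hv : Continuous v) : Continuous fun t => gmul b (u t) (v t) := by
  simp only [gmul_eq]
  fun_prop

@[fun_prop]
lemma continuous_ginv {T : Type*} [TopologicalSpace T] {u : T → G m n}
    (hu : Continuous u) : Continuous fun t => ginv (u t) := by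
  unfold ginv
  fun_prop

@[simp]
lemma gmul_zero (P : G m n) : gmul b P 0 = P := by
  simp [gmul_eq]

lemma gmul_assoc (P Q R : G m n) : gmul b (gmul b P Q) R = gmul b P (gmul b Q R) := by
  simp only [gmul_eq, bform_add_left, bform_add_right]
  ext1
  · simp [add_assoc]
  · simp only; module

lemma ginv_gmul (hskew : ∀ s, (b s).transpose = -(b s)) (P Q : G m n) :
    ginv (gmul b P Q) = gmul b (ginv Q) (ginv P) := by
  simp only [gmul_eq, ginv, bform_neg_left, bform_neg_right, bform_swap hskew Q.1 P.1]
  ext1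
  · simp [add_comm]
  · simp only; module

lemma gmul_ginv_cancel_left (hskew : ∀ s, (b s).transpose = -(b s)) (P Q : G m n) :
    gmul b P (gmul b (ginv P) Q) = Q := by
  simp only [gmul_eq, ginv, bform_neg_left, bform_add_right, bform_neg_right, bform_self hskew]
  ext1
  · simp
  · simp only; module

lemma ginv_gmul_cancel_left (hskew : ∀ s, (b s).transpose = -(b s)) (P Q : G m n) :
    gmul b (ginv P) (gmul b P Q) = Q := by
  simp only [gmul_eq, ginv, bform_neg_left, bform_add_right, bform_self hskew]
  ext1
  · simp
  · simp only; module

lemma ginv_gmul_self (hskew : ∀ s, (b s).transpose = -(b s)) (P : G m n) :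
    gmul b (ginv P) P = 0 := by
  simpa using ginv_gmul_cancel_left hskew P 0

lemma gmul_hor_hor (hskew : ∀ s, (b s).transpose = -(b s)) (P : G m n) (s t : ℝ)
    (v : Fin m → ℝ) :
    gmul b (gmul b P (s • v, 0)) (t • v, 0) = gmul b P ((s + t) • v, 0) := by
  rw [gmul_assoc]
  congr 1
  simp [gmul_eq, bform_smul_left, bform_smul_right, bform_self hskew, add_smul]

lemma enorm_bform_le (x y : Fin m → ℝ) :
    enorm (bform b x y) ≤ (∑ s, ∑ i, ∑ j, |b s i j|) * (enorm x * enorm y) := by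
  refine (enorm_le_sum_abs _).trans ?_
  simp only [Finset.sum_mul, bform]
  refine Finset.sum_le_sum fun s _ => (Finset.abs_sum_le_sum_abs _ _).trans
    (Finset.sum_le_sum fun i _ => (Finset.abs_sum_le_sum_abs _ _).trans
    (Finset.sum_le_sum fun j _ => ?_))
  rw [abs_mul, abs_mul, mul_assoc]
  have hx := abs_apply_le_enorm x j
  have hy := abs_apply_le_enorm y i
  gcongr
  exact enorm_nonneg x

variable (b) in
/-- Quasi-triangle inequality. -/
lemma exists_qnorm_gmul_le : ∃ C > 0, ∀ P Q : G m n,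
    qnorm (gmul b P Q) ≤ C * (qnorm P + qnorm Q) := by
  set K : ℝ := ∑ s, ∑ i, ∑ j, |b s i j| with hK
  have hK0 : 0 ≤ K := by positivity
  refine ⟨1 + √K, by positivity, fun P Q => ?_⟩
  have h1 : enorm (P.1 + Q.1) ≤ enorm P.1 + enorm Q.1 := enorm_add_le _ _
  have hsq : ∀ u v : ℝ, 0 ≤ u → 0 ≤ v → √(u + v) ≤ √u + √v := fun u v hu hv => by
    rw [Real.sqrt_le_left (by positivity)]
    nlinarith [Real.sq_sqrt hu, Real.sq_sqrt hv, Real.sqrt_nonneg u, Real.sqrt_nonneg v]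
  have hp := enorm_nonneg P.1
  have hq := enorm_nonneg Q.1
  have h2 : enorm (P.2 + Q.2 + (1 / 2 : ℝ) • bform b P.1 Q.1) ≤
      enorm P.2 + enorm Q.2 + K * (enorm P.1 + enorm Q.1) ^ 2 := by
    refine (enorm_add_le _ _).trans (add_le_add (enorm_add_le _ _) ?_)
    rw [enorm_smul, abs_of_pos (by norm_num)]
    have := enorm_bform_le (b := b) P.1 Q.1
    have h4 : K * (enorm P.1 * enorm Q.1) ≤ K * (enorm P.1 + enorm Q.1) ^ 2 :=
      mul_le_mul_of_nonneg_left (by nlinarith) hK0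
    linarith [enorm_nonneg (bform b P.1 Q.1)]
  have h3 : √(enorm (P.2 + Q.2 + (1 / 2 : ℝ) • bform b P.1 Q.1)) ≤
      √(enorm P.2) + √(enorm Q.2) + √K * (enorm P.1 + enorm Q.1) := by
    refine (Real.sqrt_le_sqrt h2).trans ((hsq _ _ (add_nonneg (enorm_nonneg _) (enorm_nonneg _))
      (by positivity)).trans (add_le_add (hsq _ _ (enorm_nonneg _) (enorm_nonneg _)) ?_))
    rw [Real.sqrt_mul hK0, Real.sqrt_sq (by positivity)]
  rw [gmul_eq]
  simp only [qnorm]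
  have h5 : 0 ≤ √K * (√(enorm P.2) + √(enorm Q.2)) := by positivity
  linarith

end Group

/-! ### Uniform first-order expansion of functions of class `C¹_G` -/

section Increment

variable {m n : ℕ} {b : Fin n → Matrix (Fin m) (Fin m) ℝ} {U : Set (G m n)} {f : G m n → ℝ}
  {gradf : G m n → Fin m → ℝ}

lemma C1Gs.hasDerivAt_comp (hskew : ∀ s, (b s).transpose = -(b s)) (hU : IsOpen U)
    (hf : C1Gs m n b U f gradf) (P : G m n) (v : Fin m → ℝ) (s : ℝ)
    (hs : gmul b P (s • v, 0) ∈ U) :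
    HasDerivAt (fun s : ℝ => f (gmul b P (s • v, 0)))
      (∑ i, gradf (gmul b P (s • v, 0)) i * v i) s := by
  set R := gmul b P (s • v, 0) with hR
  have hstep : ∀ t : ℝ, gmul b P (t • v, 0) = gmul b R ((t - s) • v, 0) := fun t => by
    rw [hR, gmul_hor_hor hskew]
    congr 3
    ring
  have hq : ∀ t : ℝ, qnorm (gmul b (ginv R) (gmul b P (t • v, 0))) = |t - s| * enorm v :=
    fun t => by rw [hstep, ginv_gmul_cancel_left hskew]; simp [qnorm, enorm_smul]
  have hx : ∀ t : ℝ, ∀ i, (gmul b P (t • v, 0)).1 i - R.1 i = (t - s) * v i := fun t i => by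
    rw [hstep]; simp [gmul_eq]
  have hcont : Continuous fun t : ℝ => gmul b P (t • v, 0) := by fun_prop
  rw [hasDerivAt_iff_isLittleO, Asymptotics.isLittleO_iff]
  intro ε hε
  have hv := enorm_nonneg v
  obtain ⟨r, hr, h⟩ := hf.2.2 R hs (ε / (1 + enorm v)) (by positivity)
  have hsmall : ∀ᶠ t in 𝓝 s, |t - s| * enorm v < r := by
    have : Continuous fun t : ℝ => |t - s| * enorm v := by fun_prop
    exact this.continuousAt.eventually_lt continuousAt_const (by simpa using hr)
  filter_upwards [hsmall, hcont.continuousAt.eventually_mem (hU.mem_nhds hs)] with t ht htU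
  have := h _ htU (by rwa [hq])
  rw [hq] at this
  simp only [hx] at this
  have hsum : ∑ i, gradf R i * ((t - s) * v i) = (t - s) • ∑ i, gradf R i * v i := by
    rw [smul_eq_mul, Finset.mul_sum]
    exact Finset.sum_congr rfl fun i _ => by ring
  rw [hsum] at this
  refine this.trans ?_
  rw [Real.norm_eq_abs]
  calc ε / (1 + enorm v) * (|t - s| * enorm v) = ε * |t - s| * (enorm v / (1 + enorm v)) := by ring
    _ ≤ ε * |t - s| * 1 := by
        gcongr
        rw [div_le_one (by positivity)]
        linarith
    _ = ε * |t - s| := mul_one _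

/-- The increments of `f` by right translation with `θ z` are approximated by the horizontal
differential of `f`, locally uniformly and up to an error `o(N z)`. -/
def UniformIncrement (b : Fin n → Matrix (Fin m) (Fin m) ℝ) (U : Set (G m n)) (f : G m n → ℝ)
    (gradf : G m n → Fin m → ℝ) (θ : G m n → G m n) : Prop :=
  ∀ P₀ ∈ U, ∀ ε > 0, ∀ᶠ q : G m n × G m n in 𝓝 (P₀, 0),
    |f (gmul b q.1 (θ q.2)) - f q.1 - ∑ i, gradf P₀ i * (θ q.2).1 i| ≤ ε * qnorm q.2

lemma UniformIncrement.gmul {θ θ' : G m n → G m n} (h : UniformIncrement b U f gradf θ)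
    (h' : UniformIncrement b U f gradf θ') (hθ : Tendsto θ (𝓝 0) (𝓝 0)) :
    UniformIncrement b U f gradf fun z => gmul b (θ z) (θ' z) := by
  intro P₀ hP₀ ε hε
  have htend : Tendsto (fun q : G m n × G m n => (Carnot.gmul b q.1 (θ q.2), q.2))
      (𝓝 (P₀, 0)) (𝓝 (P₀, 0)) := by
    have hc : Continuous fun q : G m n × G m n => Carnot.gmul b q.1 q.2 := by fun_prop
    have h1 : Tendsto (fun q : G m n × G m n => (q.1, θ q.2)) (𝓝 (P₀, 0)) (𝓝 (P₀, 0)) := by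
      rw [nhds_prod_eq]
      exact tendsto_fst.prodMk (hθ.comp tendsto_snd)
    have h2 : Tendsto (fun q : G m n × G m n => Carnot.gmul b q.1 q.2) (𝓝 (P₀, 0)) (𝓝 P₀) := by
      simpa using hc.tendsto (P₀, 0)
    exact (h2.comp h1).prodMk_nhds continuousAt_snd
  filter_upwards [h P₀ hP₀ (ε / 2) (by positivity),
    htend.eventually (h' P₀ hP₀ (ε / 2) (by positivity))] with q h1 h2
  rw [gmul_assoc] at h2
  have hx : ∑ i, gradf P₀ i * (Carnot.gmul b (θ q.2) (θ' q.2)).1 i =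
      ∑ i, gradf P₀ i * (θ q.2).1 i + ∑ i, gradf P₀ i * (θ' q.2).1 i := by
    simp [gmul_eq, mul_add, Finset.sum_add_distrib]
  rw [hx]
  have := (abs_add_le _ _).trans (add_le_add h1 h2)
  ring_nf at this ⊢
  exact this

lemma C1Gs.uniformIncrement_horizontal (hskew : ∀ s, (b s).transpose = -(b s)) (hU : IsOpen U)
    (hf : C1Gs m n b U f gradf) {v : G m n → Fin m → ℝ} (hv : Tendsto v (𝓝 0) (𝓝 0)) {C : ℝ}
    (hC : ∀ z, enorm (v z) ≤ C * qnorm z) :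
    UniformIncrement b U f gradf fun z => (v z, 0) := by
  intro P₀ hP₀ ε hε
  set δ : ℝ := ε / (1 + |C|) with hδ
  have hδ0 : 0 < δ := by positivity
  have hgrad : ∀ᶠ P in 𝓝 P₀, P ∈ U ∧ ∑ i, |gradf P i - gradf P₀ i| < δ := by
    have hc : ContinuousAt gradf P₀ := hf.2.1.continuousAt (hU.mem_nhds hP₀)
    have hc' : ContinuousAt (fun P => ∑ i, |gradf P i - gradf P₀ i|) P₀ := by
      have := continuousAt_pi.1 hc
      fun_prop
    exact (hU.eventually_mem hP₀).and (hc'.eventually_lt continuousAt_const (by simpa using hδ0))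
  have hseg : ∀ᶠ q : G m n × (Fin m → ℝ) in 𝓝 (P₀, 0), ∀ s ∈ Icc (0 : ℝ) 1,
      Carnot.gmul b q.1 (s • q.2, 0) ∈ U ∧
        ∑ i, |gradf (Carnot.gmul b q.1 (s • q.2, 0)) i - gradf P₀ i| < δ := by
    refine isCompact_Icc.eventually_forall_of_forall_eventually fun s _ => ?_
    have hc : Continuous fun z : (G m n × (Fin m → ℝ)) × ℝ =>
        Carnot.gmul b z.1.1 (z.2 • z.1.2, 0) := by fun_prop
    have ht : Tendsto (fun z : (G m n × (Fin m → ℝ)) × ℝ =>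
        Carnot.gmul b z.1.1 (z.2 • z.1.2, 0)) (𝓝 ((P₀, 0), s)) (𝓝 P₀) := by
      simpa [gmul_eq] using hc.tendsto ((P₀, 0), s)
    exact ht.eventually hgrad
  have htend : Tendsto (fun q : G m n × G m n => (q.1, v q.2)) (𝓝 (P₀, 0)) (𝓝 (P₀, 0)) := by
    simp only [nhds_prod_eq]
    exact tendsto_fst.prodMk (hv.comp tendsto_snd)
  filter_upwards [htend.eventually hseg] with q hq
  have hderiv : ∀ s ∈ Icc (0 : ℝ) 1, HasDerivWithinAt
      (fun s : ℝ => f (Carnot.gmul b q.1 (s • v q.2, 0)) - s * ∑ i, gradf P₀ i * v q.2 i)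
      (∑ i, gradf (Carnot.gmul b q.1 (s • v q.2, 0)) i * v q.2 i - ∑ i, gradf P₀ i * v q.2 i)
      (Icc 0 1) s := fun s hs =>
    ((hf.hasDerivAt_comp hskew hU q.1 (v q.2) s (hq s hs).1).sub
      (hasDerivAt_mul_const _)).hasDerivWithinAt
  have hbound := norm_image_sub_le_of_norm_deriv_le_segment_01' (C := δ * enorm (v q.2)) hderiv
    fun s hs => by
      rw [← Finset.sum_sub_distrib]
      simp only [← sub_mul]
      refine (abs_sum_mul_le _ _).trans ?_
      have := (hq s ⟨hs.1, hs.2.le⟩).2.le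
      gcongr
      exact enorm_nonneg _
  have h0 : (((0 : Fin m → ℝ), (0 : Fin n → ℝ)) : G m n) = 0 := rfl
  simp only [one_smul, zero_smul, one_mul, zero_mul, sub_zero, h0, gmul_zero,
    Real.norm_eq_abs] at hbound
  calc |f (Carnot.gmul b q.1 (v q.2, 0)) - f q.1 - ∑ i, gradf P₀ i * v q.2 i|
      = |f (Carnot.gmul b q.1 (v q.2, 0)) - ∑ i, gradf P₀ i * v q.2 i - f q.1| := by ring_nf
    _ ≤ δ * enorm (v q.2) := hbound
    _ ≤ δ * ((1 + |C|) * qnorm q.2) := by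
        have := hC q.2
        have h2 : C * qnorm q.2 ≤ (1 + |C|) * qnorm q.2 :=
          mul_le_mul_of_nonneg_right (by linarith [le_abs_self C]) (qnorm_nonneg _)
        gcongr
        linarith
    _ = ε * qnorm q.2 := by rw [hδ]; field_simp

/-- Vertical increments in the direction of a commutator of two horizontal fields. -/
lemma C1Gs.uniformIncrement_commutator (hskew : ∀ s, (b s).transpose = -(b s)) (hU : IsOpen U)
    (hf : C1Gs m n b U f gradf) (u v : Fin m → ℝ) {c : G m n → ℝ} (hc : Tendsto c (𝓝 0) (𝓝 0))
    {C : ℝ} (hC : ∀ z, √|c z| ≤ C * qnorm z) :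
    UniformIncrement b U f gradf fun z => (0, c z • bform b u v) := by
  set σ : G m n → ℝ := fun z => √|c z|
  set τ : G m n → ℝ := fun z => SignType.sign (c z) * √|c z|
  have hστ : ∀ z, σ z * τ z = c z := fun z => by
    simp only [σ, τ]
    rw [mul_left_comm, Real.mul_self_sqrt (abs_nonneg _), sign_mul_abs]
  have hσC : ∀ z, |σ z| ≤ C * qnorm z := fun z => by
    rw [abs_of_nonneg (Real.sqrt_nonneg _)]; exact hC z
  have hτC : ∀ z, |τ z| ≤ C * qnorm z := fun z => by
    refine le_trans ?_ (hC z)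
    simp only [τ, abs_mul, abs_of_nonneg (Real.sqrt_nonneg _)]
    refine mul_le_of_le_one_left (Real.sqrt_nonneg _) ?_
    rcases lt_trichotomy (c z) 0 with h | h | h <;> simp [h]
  have hσ0 : Tendsto σ (𝓝 0) (𝓝 0) := by simpa using hc.abs.sqrt
  have hτ0 : Tendsto τ (𝓝 0) (𝓝 0) := by
    refine squeeze_zero_norm (fun z => ?_) hσ0
    simp only [τ, σ, norm_mul, Real.norm_eq_abs, abs_of_nonneg (Real.sqrt_nonneg _)]
    refine mul_le_of_le_one_left (Real.sqrt_nonneg _) ?_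
    rcases lt_trichotomy (c z) 0 with h | h | h <;> simp [h]
  have hor : ∀ (a : G m n → ℝ) (x : Fin m → ℝ), Tendsto a (𝓝 0) (𝓝 0) →
      (∀ z, |a z| ≤ C * qnorm z) → Tendsto (fun z => ((a z • x, 0) : G m n)) (𝓝 0) (𝓝 0) ∧
      UniformIncrement b U f gradf fun z => (a z • x, 0) := fun a x ha haC => by
    have h1 : Tendsto (fun z => a z • x) (𝓝 0) (𝓝 0) := by simpa using ha.smul_const x
    refine ⟨h1.prodMk_nhds tendsto_const_nhds,
      hf.uniformIncrement_horizontal hskew hU h1 (C := C * enorm x) fun z => ?_⟩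
    rw [enorm_smul]
    nlinarith [haC z, enorm_nonneg x]
  have hneg : ∀ a : G m n → ℝ, Tendsto a (𝓝 0) (𝓝 0) → Tendsto (fun z => -a z) (𝓝 0) (𝓝 0) :=
    fun a ha => by simpa using ha.neg
  obtain ⟨t1, i1⟩ := hor σ u hσ0 hσC
  obtain ⟨t2, i2⟩ := hor τ v hτ0 hτC
  obtain ⟨t3, i3⟩ := hor (fun z => -σ z) u (hneg σ hσ0) (by simpa using hσC)
  obtain ⟨t4, i4⟩ := hor (fun z => -τ z) v (hneg τ hτ0) (by simpa using hτC)
  have i34 := i3.gmul i4 t3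
  have tmul : ∀ {θ θ' : G m n → G m n}, Tendsto θ (𝓝 0) (𝓝 0) → Tendsto θ' (𝓝 0) (𝓝 0) →
      Tendsto (fun z => Carnot.gmul b (θ z) (θ' z)) (𝓝 0) (𝓝 0) := fun {θ θ'} h h' => by
    have hcont : Continuous fun q : G m n × G m n => Carnot.gmul b q.1 q.2 := by fun_prop
    have h0 := hcont.tendsto (0, 0)
    simp only [gmul_zero] at h0
    exact h0.comp (h.prodMk_nhds h')
  convert (i1.gmul i2 t1).gmul i34 (tmul t1 t2) using 2 with z
  simp only [gmul_eq, bform_smul_left, bform_smul_right, bform_add_left, bform_add_right,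
    bform_self hskew, bform_swap hskew v u]
  ext1
  · simp only; module
  · simp only [← hστ z]; module

lemma surjective_sum_smul_bform_single (hind : LinearIndependent ℝ b) :
    ∃ g : (Fin n → ℝ) →ₗ[ℝ] (Fin m × Fin m → ℝ), ∀ y,
      ∑ k, g y k • bform b (Pi.single k.2 1) (Pi.single k.1 1) = y := by
  set A : Matrix (Fin n) (Fin m × Fin m) ℝ := Matrix.of fun s k => b s k.1 k.2 with hA
  have hli : LinearIndependent ℝ A.row := by
    have := hind.map' (LinearEquiv.curry ℝ ℝ (Fin m) (Fin m)).symm.toLinearMap (LinearEquiv.ker _)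
    exact this
  have hrank := hli.rank_matrix
  have hrange : LinearMap.range A.mulVecLin = ⊤ := by
    apply Submodule.eq_top_of_finrank_eq
    rw [← Matrix.rank, hrank]
    simp
  obtain ⟨g, hg⟩ := LinearMap.exists_rightInverse_of_surjective _ hrange
  refine ⟨g, fun y => ?_⟩
  have := LinearMap.congr_fun hg y
  simp only [LinearMap.comp_apply, Matrix.mulVecLin_apply, LinearMap.id_apply] at this
  conv_rhs => rw [← this]
  ext s
  simp [bform_single, Matrix.mulVec, dotProduct, hA, mul_comm]

/-- Local uniformity of the first-order expansion of a function of class `C¹_G`. -/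
theorem C1Gs.eventually_abs_sub_le (hskew : ∀ s, (b s).transpose = -(b s))
    (hind : LinearIndependent ℝ b) (hU : IsOpen U) (hf : C1Gs m n b U f gradf) {P₀ : G m n}
    (hP₀ : P₀ ∈ U) {ε : ℝ} (hε : 0 < ε) :
    ∀ᶠ q : G m n × G m n in 𝓝 (P₀, P₀),
      |f q.2 - f q.1 - ∑ i, gradf P₀ i * (q.2.1 i - q.1.1 i)| ≤
        ε * qnorm (Carnot.gmul b (ginv q.1) q.2) := by
  obtain ⟨g, hg⟩ := surjective_sum_smul_bform_single hind
  have hgc : Continuous g := g.continuous_of_finiteDimensional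
  have hz2 : Tendsto (fun z : G m n => z.2) (𝓝 0) (𝓝 0) := continuous_snd.tendsto 0
  have hz1 : Tendsto (fun z : G m n => z.1) (𝓝 0) (𝓝 0) := continuous_fst.tendsto 0
  have hvert : ∀ s : Finset (Fin m × Fin m), UniformIncrement b U f gradf fun z =>
      (0, ∑ k ∈ s, g z.2 k • bform b (Pi.single k.2 1) (Pi.single k.1 1)) := by
    intro s
    induction s using Finset.induction_on with
    | empty =>
      simpa using hf.uniformIncrement_horizontal hskew hU (v := fun _ => 0) (C := 0)
        tendsto_const_nhds (by simp)
    | insert k s hk ih =>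
      have hck : Tendsto (fun z : G m n => g z.2 k) (𝓝 0) (𝓝 0) := by
        have : Continuous fun z : G m n => g z.2 k := by fun_prop
        simpa using this.tendsto 0
      obtain ⟨C, hC⟩ : ∃ C, ∀ y, |g y k| ≤ C * enorm y := by
        refine ⟨∑ i, |g (Pi.single i 1) k|, fun y => ?_⟩
        refine le_trans (le_of_eq ?_) (abs_sum_mul_le (fun i => g (Pi.single i 1) k) y)
        have hy : y = ∑ i, y i • (Pi.single i 1 : Fin n → ℝ) := by
          simp only [← Pi.single_smul, smul_eq_mul, mul_one, Finset.univ_sum_single]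
        conv_lhs => rw [hy]
        simp [mul_comm]
      have hk1 := hf.uniformIncrement_commutator hskew hU (Pi.single k.2 1) (Pi.single k.1 1) hck
        (C := √|C|) fun z => by
          calc √|g z.2 k| ≤ √(|C| * enorm z.2) := Real.sqrt_le_sqrt ((hC z.2).trans
                (mul_le_mul_of_nonneg_right (le_abs_self C) (enorm_nonneg _)))
            _ = √|C| * √(enorm z.2) := Real.sqrt_mul (abs_nonneg _) _
            _ ≤ √|C| * qnorm z := by
                gcongr
                exact sqrt_enorm_snd_le_qnorm z
      have ht : Tendsto (fun z : G m n =>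
          ((0, g z.2 k • bform b (Pi.single k.2 1) (Pi.single k.1 1)) : G m n))
          (𝓝 0) (𝓝 0) := by
        refine tendsto_const_nhds.prodMk_nhds ?_
        simpa using hck.smul_const (bform b (Pi.single k.2 1) (Pi.single k.1 1))
      convert hk1.gmul ih ht using 2 with z
      simp [gmul_eq, Finset.sum_insert hk]
  have hhor : UniformIncrement b U f gradf fun z => (z.1, 0) :=
    hf.uniformIncrement_horizontal hskew hU hz1 (C := 1) fun z => by
      rw [one_mul]; exact enorm_fst_le_qnorm z
  have hid : UniformIncrement b U f gradf fun z => z := by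
    convert hhor.gmul (hvert Finset.univ) (hz1.prodMk_nhds tendsto_const_nhds) using 2 with z
    simp [gmul_eq, hg]
  have hc : Continuous fun q : G m n × G m n => (q.1, Carnot.gmul b (ginv q.1) q.2) := by fun_prop
  have ht := hc.tendsto (P₀, P₀)
  simp only [ginv_gmul_self hskew] at ht
  filter_upwards [ht.eventually (hid P₀ hP₀ ε hε)] with q hq
  rw [gmul_ginv_cancel_left hskew] at hq
  convert hq using 5 with i
  simp [gmul_eq, ginv, sub_eq_neg_add]

end Increment

/-! ### Intrinsic graphs of codimension one -/

section Graph

variable {m n : ℕ} {b : Fin n → Matrix (Fin m) (Fin m) ℝ}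

lemma eq_zero_or_eq_idx1 (h0 : 0 < m) (i : Fin m) : i = ⟨0, h0⟩ ∨ ∃ k, i = idx1 m k := by
  obtain ⟨i, hi⟩ := i
  rcases i with _ | i
  · exact Or.inl rfl
  · exact Or.inr ⟨⟨i, by omega⟩, rfl⟩

@[simp]
lemma idx1_ne_zero (h0 : 0 < m) (i : Fin (m - 1)) : idx1 m i ≠ ⟨0, h0⟩ := by
  simp [idx1]

@[simp]
lemma idx1_inj {i j : Fin (m - 1)} : idx1 m i = idx1 m j ↔ i = j := by
  simp [idx1, Fin.ext_iff]

lemma sum_eq_zero_add_sum_idx1 (h0 : 0 < m) (F : Fin m → ℝ) :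
    ∑ i, F i = F ⟨0, h0⟩ + ∑ i, F (idx1 m i) := by
  obtain ⟨m, rfl⟩ : ∃ k, m = k + 1 := ⟨m - 1, by omega⟩
  rw [Fin.sum_univ_succ]
  rfl

@[simp]
lemma embW_fst_zero (h0 : 0 < m) (A : W m n 1) : (embW m n 1 A).1 ⟨0, h0⟩ = 0 := by
  simp [embW]

@[simp]
lemma embW_fst_idx1 (A : W m n 1) (i : Fin (m - 1)) : (embW m n 1 A).1 (idx1 m i) = A.1 i := by
  simp [embW, idx1]

@[simp]
lemma embW_snd (A : W m n 1) : (embW m n 1 A).2 = A.2 := rfl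

lemma embH_const (h0 : 0 < m) (t : ℝ) :
    embH m n 1 (fun _ => t) = (t • Pi.single ⟨0, h0⟩ 1, 0) := by
  refine Prod.ext (funext fun i => ?_) rfl
  rcases eq_zero_or_eq_idx1 h0 i with rfl | ⟨k, rfl⟩
  · simp [embH]
  · simp [embH, idx1]

lemma embW_fst_add_smul_single (h0 : 0 < m) (A : W m n 1) (h : ℝ) (j : Fin (m - 1))
    (y : Fin n → ℝ) : (embW m n 1 (A + h • (Pi.single j 1, y))).1 =
      (embW m n 1 A).1 + h • Pi.single (idx1 m j) 1 := by
  ext i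
  rcases eq_zero_or_eq_idx1 h0 i with rfl | ⟨k, rfl⟩
  · simp [(idx1_ne_zero h0 j).symm]
  · simp [Pi.single_apply]

@[fun_prop]
lemma continuous_embW {T : Type*} [TopologicalSpace T] {u : T → W m n 1} (hu : Continuous u) :
    Continuous fun t => embW m n 1 (u t) := by
  refine Continuous.prodMk (continuous_pi fun j => ?_) (by fun_prop)
  split_ifs <;> fun_prop

lemma graphMapS_eq (h0 : 0 < m) (ψ : W m n 1 → ℝ) (A : W m n 1) : graphMapS m n b ψ A =
    gmul b (embW m n 1 A) (ψ A • Pi.single ⟨0, h0⟩ 1, 0) := by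
  rw [graphMapS, graphMap, embH_const h0]

lemma graphMapS_fst_zero (h0 : 0 < m) (ψ : W m n 1 → ℝ) (A : W m n 1) :
    (graphMapS m n b ψ A).1 ⟨0, h0⟩ = ψ A := by
  simp [graphMapS_eq h0, gmul_eq]

lemma graphMapS_fst_idx1 (h0 : 0 < m) (ψ : W m n 1 → ℝ) (A : W m n 1) (i : Fin (m - 1)) :
    (graphMapS m n b ψ A).1 (idx1 m i) = A.1 i := by
  simp [graphMapS_eq h0, gmul_eq]

lemma continuousAt_graphMapS (h0 : 0 < m) {ψ : W m n 1 → ℝ} {A : W m n 1}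
    (hψ : ContinuousAt ψ A) : ContinuousAt (graphMapS m n b ψ) A := by
  have hc : Continuous fun q : W m n 1 × ℝ =>
      gmul b (embW m n 1 q.1) (q.2 • Pi.single ⟨0, h0⟩ 1, 0) := by fun_prop
  have := hc.continuousAt.comp (f := fun A => (A, ψ A)) (continuousAt_id.prodMk hψ)
  exact this.congr (Eventually.of_forall fun A => (graphMapS_eq h0 ψ A).symm)

lemma sigma_eq_qnorm (hskew : ∀ s, (b s).transpose = -(b s)) (h0 : 0 < m) (ψ : W m n 1 → ℝ)
    (A B : W m n 1) : sigma m n 1 b (fun A' _ => ψ A') A B =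
      qnorm (gmul b (ginv (graphMapS m n b ψ A))
        (gmul b (embW m n 1 B) (ψ A • Pi.single ⟨0, h0⟩ 1, 0))) := by
  rw [graphMapS_eq h0, sigma, embH_const h0, ginv_gmul hskew, gmul_assoc]

lemma sigma_nonneg (ψ : W m n 1 → ℝ) (A B : W m n 1) :
    0 ≤ sigma m n 1 b (fun A' _ => ψ A') A B := qnorm_nonneg _

lemma abs_fst_sub_le_sigma (hskew : ∀ s, (b s).transpose = -(b s)) (h0 : 0 < m)
    (ψ : W m n 1 → ℝ) (A B : W m n 1) (i : Fin (m - 1)) :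
    |B.1 i - A.1 i| ≤ sigma m n 1 b (fun A' _ => ψ A') A B := by
  rw [sigma_eq_qnorm hskew h0]
  refine le_trans (le_of_eq ?_) ((abs_apply_le_enorm _ (idx1 m i)).trans (enorm_fst_le_qnorm _))
  simp [graphMapS_eq h0, gmul_eq, ginv]
  ring_nf

lemma exists_qnorm_ginv_graphMapS_le (hskew : ∀ s, (b s).transpose = -(b s)) (h0 : 0 < m) :
    ∃ C > 0, ∀ (ψ : W m n 1 → ℝ) (A B : W m n 1),
      qnorm (gmul b (ginv (graphMapS m n b ψ A)) (graphMapS m n b ψ B)) ≤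
        C * (sigma m n 1 b (fun A' _ => ψ A') A B + |ψ B - ψ A|) := by
  obtain ⟨C, hC, h⟩ := exists_qnorm_gmul_le b
  refine ⟨C, hC, fun ψ A B => ?_⟩
  have := h (gmul b (ginv (graphMapS m n b ψ A))
    (gmul b (embW m n 1 B) (ψ A • Pi.single ⟨0, h0⟩ 1, 0)))
    ((ψ B - ψ A) • Pi.single ⟨0, h0⟩ 1, 0)
  rw [← sigma_eq_qnorm hskew h0, gmul_assoc, gmul_hor_hor hskew, add_sub_cancel,
    ← graphMapS_eq h0] at this
  refine this.trans (le_of_eq ?_)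
  simp [qnorm, enorm_smul, enorm_single]

/-- The intrinsic gradient `-(X₂f/X₁f, …, X_mf/X₁f) ∘ Φ` of the level set of `f`. -/
def levelGrad (b : Fin n → Matrix (Fin m) (Fin m) ℝ) (h0 : 0 < m) (gradf : G m n → Fin m → ℝ)
    (ψ : W m n 1 → ℝ) (A : W m n 1) (i : Fin (m - 1)) : ℝ :=
  -(gradf (graphMapS m n b ψ A) (idx1 m i) / gradf (graphMapS m n b ψ A) ⟨0, h0⟩)

variable {U : Set (G m n)} {f : G m n → ℝ} {gradf : G m n → Fin m → ℝ} {O : Set (W m n 1)}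
  {ψ : W m n 1 → ℝ}

lemma continuousOn_levelGrad (h0 : 0 < m) (hU : IsOpen U) (hf : C1Gs m n b U f gradf)
    (hX1 : ∀ Q ∈ U, 0 < gradf Q ⟨0, h0⟩) (hO : IsOpen O) (hψ : ContinuousOn ψ O)
    (hsub : ∀ A ∈ O, graphMapS m n b ψ A ∈ U) : ContinuousOn (levelGrad b h0 gradf ψ) O := by
  intro A hA
  refine ContinuousAt.continuousWithinAt (continuousAt_pi.2 fun i => ?_)
  have h1 : ContinuousAt (fun A => gradf (graphMapS m n b ψ A)) A :=
    ContinuousAt.comp (g := gradf) (hf.2.1.continuousAt (hU.mem_nhds (hsub A hA)))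
      (continuousAt_graphMapS h0 (hψ.continuousAt (hO.mem_nhds hA)))
  have h2 := continuousAt_pi.1 h1
  exact ((h2 _).div (h2 _) (hX1 _ (hsub A hA)).ne').neg

lemma eventually_abs_sub_le_sigma (hskew : ∀ s, (b s).transpose = -(b s))
    (hind : LinearIndependent ℝ b) (h0 : 0 < m) (hU : IsOpen U) (hf : C1Gs m n b U f gradf)
    (hX1 : ∀ Q ∈ U, 0 < gradf Q ⟨0, h0⟩) (hO : IsOpen O) (hψ : ContinuousOn ψ O)
    (hsub : ∀ A ∈ O, graphMapS m n b ψ A ∈ U) (hzero : ∀ A ∈ O, f (graphMapS m n b ψ A) = 0)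
    {A₀ : W m n 1} (hA₀ : A₀ ∈ O) {ε : ℝ} (hε : 0 < ε) :
    ∀ᶠ q : W m n 1 × W m n 1 in 𝓝 (A₀, A₀),
      |ψ q.2 - ψ q.1 - ∑ i, levelGrad b h0 gradf ψ A₀ i * (q.2.1 i - q.1.1 i)| ≤
        ε * sigma m n 1 b (fun A' _ => ψ A') q.1 q.2 := by
  obtain ⟨C, hC, hCle⟩ := exists_qnorm_ginv_graphMapS_le (n := n) (b := b) hskew h0
  set P₀ := graphMapS m n b ψ A₀ with hP₀
  set d := gradf P₀ ⟨0, h0⟩ with hd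
  have hd0 : 0 < d := hX1 _ (hsub A₀ hA₀)
  set L : ℝ := ∑ i, |levelGrad b h0 gradf ψ A₀ i| with hL
  have hL0 : 0 ≤ L := by positivity
  set δ : ℝ := min (1 / 2) (ε / (2 * (1 + L))) with hδ
  have hδ0 : 0 < δ := by positivity
  have hΦ : ContinuousAt (graphMapS m n b ψ) A₀ :=
    continuousAt_graphMapS h0 (hψ.continuousAt (hO.mem_nhds hA₀))
  have hpair : Tendsto (fun q : W m n 1 × W m n 1 => (graphMapS m n b ψ q.1, graphMapS m n b ψ q.2))
      (𝓝 (A₀, A₀)) (𝓝 (P₀, P₀)) := by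
    simp only [nhds_prod_eq]
    exact hΦ.tendsto.prodMap hΦ.tendsto
  have hmem : ∀ᶠ q : W m n 1 × W m n 1 in 𝓝 (A₀, A₀), q.1 ∈ O ∧ q.2 ∈ O :=
    (continuousAt_fst.eventually_mem (hO.mem_nhds hA₀)).and
      (continuousAt_snd.eventually_mem (hO.mem_nhds hA₀))
  filter_upwards [hmem, hpair.eventually (hf.eventually_abs_sub_le hskew hind hU (hsub A₀ hA₀)
    (ε := δ * d / C) (by positivity))] with q hq hle
  rw [hzero _ hq.1, hzero _ hq.2, sum_eq_zero_add_sum_idx1 h0, sub_zero, zero_sub, abs_neg] at hle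
  simp only [graphMapS_fst_zero, graphMapS_fst_idx1 h0] at hle
  set S := sigma m n 1 b (fun A' _ => ψ A') q.1 q.2 with hS
  have hS0 : 0 ≤ S := sigma_nonneg ψ _ _
  set D := ψ q.2 - ψ q.1 with hD
  set Λ := ∑ i, levelGrad b h0 gradf ψ A₀ i * (q.2.1 i - q.1.1 i) with hΛ
  have hsum : d * D + ∑ i, gradf P₀ (idx1 m i) * (q.2.1 i - q.1.1 i) = d * (D - Λ) := by
    rw [hΛ, mul_sub d D, Finset.mul_sum, sub_eq_add_neg, ← Finset.sum_neg_distrib]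
    congr 1
    refine Finset.sum_congr rfl fun i _ => ?_
    rw [levelGrad, ← hP₀, ← hd]
    field_simp
  rw [hsum, abs_mul, abs_of_pos hd0] at hle
  have hle' : |D - Λ| ≤ δ * (S + |D|) := by
    have h1 := hle.trans (mul_le_mul_of_nonneg_left (hCle ψ q.1 q.2) (by positivity))
    have h2 : δ * d / C * (C * (S + |D|)) = d * (δ * (S + |D|)) := by field_simp
    rw [h2] at h1
    exact le_of_mul_le_mul_left h1 hd0
  have hΛle : |Λ| ≤ L * S := by
    rw [hΛ, hL, Finset.sum_mul]
    refine (Finset.abs_sum_le_sum_abs _ _).trans (Finset.sum_le_sum fun i _ => ?_)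
    rw [abs_mul]
    exact mul_le_mul_of_nonneg_left (abs_fst_sub_le_sigma hskew h0 ψ _ _ i) (abs_nonneg _)
  have hDle : |D| ≤ |D - Λ| + |Λ| := by simpa using abs_add_le (D - Λ) Λ
  have hδ1 : δ ≤ 1 / 2 := min_le_left _ _
  have hδ2 : δ * (2 * (1 + L)) ≤ ε := (le_div_iff₀ (by positivity)).1 (min_le_right _ _)
  have h3 : |D - Λ| ≤ δ * (2 * (1 + L)) * S := by
    have h4 : δ * |D| ≤ δ * |D - Λ| + δ * (L * S) := by
      rw [← mul_add]
      exact mul_le_mul_of_nonneg_left (by linarith) hδ0.le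
    have h5 : δ * |D - Λ| ≤ 1 / 2 * |D - Λ| := mul_le_mul_of_nonneg_right hδ1 (abs_nonneg _)
    linarith
  exact h3.trans (mul_le_mul_of_nonneg_right hδ2 hS0)

lemma UIDs.of_eventually (hskew : ∀ s, (b s).transpose = -(b s)) {A₀ : W m n 1}
    {g : Fin (m - 1) → ℝ} (h : ∀ ε > 0, ∀ᶠ q : W m n 1 × W m n 1 in 𝓝 (A₀, A₀),
      |ψ q.2 - ψ q.1 - ∑ i, g i * (q.2.1 i - q.1.1 i)| ≤
        ε * sigma m n 1 b (fun A' _ => ψ A') q.1 q.2) : UIDs m n b O ψ A₀ g := by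
  intro ε hε
  set τ : W m n 1 → G m n → W m n 1 := fun A z =>
    (fun i => (gmul b (embW m n 1 A) z).1 (idx1 m i), (gmul b (embW m n 1 A) z).2) with hτ
  have hτA : ∀ A B, τ A (gmul b (ginv (embW m n 1 A)) (embW m n 1 B)) = B := fun A B => by
    simp [hτ, gmul_ginv_cancel_left hskew]
  have hτ0 : ∀ A, τ A 0 = A := fun A => by simp [hτ]
  have hτc : ∀ {u : G m n × G m n → W m n 1} {v : G m n × G m n → G m n}, Continuous u →
      Continuous v → Continuous fun t => τ (u t) (v t) := fun {u v} hu hv => by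
    have : Continuous fun t => gmul b (embW m n 1 (u t)) (v t) :=
      continuous_gmul (continuous_embW hu) hv
    exact (continuous_pi fun i => (continuous_apply (idx1 m i)).comp this.fst).prodMk this.snd
  have hc : Continuous fun z : G m n × G m n => (τ A₀ z.1, τ (τ A₀ z.1) z.2) :=
    (hτc continuous_const continuous_fst).prodMk
      (hτc (hτc continuous_const continuous_fst) continuous_snd)
  have ht := hc.tendsto 0
  simp only [Prod.fst_zero, Prod.snd_zero, hτ0] at ht
  have hev := ht.eventually (h ε hε)
  rw [← Prod.mk_zero_zero, nhds_prod_eq] at hev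
  obtain ⟨s, hs, s', hs', hss⟩ := Filter.eventually_prod_iff.1 hev
  obtain ⟨r, hr, hrs⟩ := exists_qnorm_lt_imp_mem hs
  obtain ⟨r', hr', hrs'⟩ := exists_qnorm_lt_imp_mem hs'
  refine ⟨min r r', lt_min hr hr', fun A _ B _ hA hB _ => ?_⟩
  have := hss (hrs _ (hA.trans_le (min_le_left _ _))) (hrs' _ (hB.trans_le (min_le_right _ _)))
  simpa only [hτA] using this

end Graph

/-! ### The intrinsic derivatives in the sense of distributions -/

section Distribution

variable {m n : ℕ} {b : Fin n → Matrix (Fin m) (Fin m) ℝ}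

/-- The linear part `x ↦ (½ ∑ l, x_l b^s_{jl})_s` of the coefficients of `D_j^ψ`. -/
def linCoeff (b : Fin n → Matrix (Fin m) (Fin m) ℝ) (j : Fin (m - 1)) :
    (Fin (m - 1) → ℝ) →L[ℝ] (Fin n → ℝ) :=
  ContinuousLinearMap.pi fun s => (1 / 2 : ℝ) •
    ∑ l, b s (idx1 m j) (idx1 m l) • ContinuousLinearMap.proj l

lemma linCoeff_apply (j : Fin (m - 1)) (x : Fin (m - 1) → ℝ) (s : Fin n) :
    linCoeff b j x s = (1 / 2) * ∑ l, x l * b s (idx1 m j) (idx1 m l) := by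
  simp [linCoeff, mul_comm]

lemma linCoeff_single_self (hskew : ∀ s, (b s).transpose = -(b s)) (j : Fin (m - 1)) :
    linCoeff b j (Pi.single j 1) = 0 := by
  ext s
  have := congr_fun (congr_fun (hskew s) (idx1 m j)) (idx1 m j)
  simp only [Matrix.transpose_apply, Matrix.neg_apply] at this
  simp [linCoeff_apply, Pi.single_apply, self_eq_neg.1 this]

lemma linCoeff_eq_bform (h0 : 0 < m) (j : Fin (m - 1)) (A : W m n 1) :
    linCoeff b j A.1 =
      (1 / 2 : ℝ) • bform b (embW m n 1 A).1 (Pi.single (idx1 m j) 1) := by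
  ext s
  simp [linCoeff_apply, bform, Pi.single_apply, sum_eq_zero_add_sum_idx1 h0, mul_comm,
    (idx1_ne_zero h0 _).symm]

lemma sigma_shear (hskew : ∀ s, (b s).transpose = -(b s)) (h0 : 0 < m) (ψ : W m n 1 → ℝ)
    (A : W m n 1) (j : Fin (m - 1)) (h t : ℝ) :
    sigma m n 1 b (fun A' _ => ψ A') A
      (shear (Pi.single j 1) (fun s => b s (idx1 m j) ⟨0, h0⟩) (linCoeff b j) h t A) =
      |h| + √(|h * (t - ψ A)| * enorm fun s => b s (idx1 m j) ⟨0, h0⟩) := by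
  rw [sigma_eq_qnorm hskew h0, graphMapS_eq h0, shear]
  set p : Fin n → ℝ := fun s => b s (idx1 m j) ⟨0, h0⟩ with hp
  have hp' : bform b (Pi.single ⟨0, h0⟩ 1) (Pi.single (idx1 m j) 1) = p := bform_single b _ _
  have key : gmul b (ginv (gmul b (embW m n 1 A) (ψ A • Pi.single ⟨0, h0⟩ 1, 0)))
      (gmul b (embW m n 1 (A + h • (Pi.single j 1, t • p + linCoeff b j A.1)))
        (ψ A • Pi.single ⟨0, h0⟩ 1, 0)) =
      (h • Pi.single (idx1 m j) 1, (h * (t - ψ A)) • p) := by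
    have hswap : bform b (Pi.single (idx1 m j) 1) (Pi.single ⟨0, h0⟩ 1) = -p := by
      rw [bform_swap hskew, hp']
    simp only [gmul_eq, ginv, embW_fst_add_smul_single h0, embW_snd, Prod.snd_add, Prod.smul_snd,
      linCoeff_eq_bform h0 j A, bform_neg_left, bform_add_left, bform_add_right, bform_smul_left,
      bform_smul_right, bform_self hskew, hp', hswap,
      bform_swap hskew (Pi.single ⟨0, h0⟩ 1) (embW m n 1 A).1]
    ext1
    · simp only; module
    · simp only; module
  rw [key]
  simp [qnorm, enorm_smul, enorm_single]

variable {U : Set (G m n)} {f : G m n → ℝ} {gradf : G m n → Fin m → ℝ} {O : Set (W m n 1)}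
  {ψ : W m n 1 → ℝ}

lemma eventually_shear_increment_le (hskew : ∀ s, (b s).transpose = -(b s))
    (h0 : 0 < m) {g : W m n 1 → Fin (m - 1) → ℝ} {A₀ : W m n 1} (hg : ContinuousAt g A₀)
    (h : ∀ ε > 0, ∀ᶠ q : W m n 1 × W m n 1 in 𝓝 (A₀, A₀),
      |ψ q.2 - ψ q.1 - ∑ i, g A₀ i * (q.2.1 i - q.1.1 i)| ≤
        ε * sigma m n 1 b (fun A' _ => ψ A') q.1 q.2) (j : Fin (m - 1)) (M : ℝ) {ε : ℝ}
    (hε : 0 < ε) :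
    ∀ᶠ q : ℝ × W m n 1 in 𝓝 (0, A₀), ∀ t ∈ Icc (-M) M,
      |ψ (shear (Pi.single j 1) (fun s => b s (idx1 m j) ⟨0, h0⟩) (linCoeff b j) q.1 t q.2) -
        ψ q.2 - q.1 * g q.2 j| ≤ ε * (|q.1| + |t - ψ q.2|) := by
  set p : Fin n → ℝ := fun s => b s (idx1 m j) ⟨0, h0⟩ with hp
  set K : ℝ := 1 + √(enorm p) with hK
  have hK0 : 0 < K := by positivity
  have hsh : ∀ᶠ q : ℝ × W m n 1 in 𝓝 (0, A₀), ∀ t ∈ Icc (-M) M,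
      |ψ (shear (Pi.single j 1) p (linCoeff b j) q.1 t q.2) - ψ q.2 -
        ∑ i, g A₀ i * ((shear (Pi.single j 1) p (linCoeff b j) q.1 t q.2).1 i - q.2.1 i)| ≤
        ε / 2 / K * sigma m n 1 b (fun A' _ => ψ A') q.2
          (shear (Pi.single j 1) p (linCoeff b j) q.1 t q.2) := by
    refine isCompact_Icc.eventually_forall_of_forall_eventually fun t _ => ?_
    have hc : Continuous fun z : (ℝ × W m n 1) × ℝ =>
        (z.1.2, shear (Pi.single j 1) p (linCoeff b j) z.1.1 z.2 z.1.2) := by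
      simp only [shear]
      fun_prop
    have ht := hc.tendsto ((0, A₀), t)
    simp only [shear_zero] at ht
    exact ht.eventually (h (ε / 2 / K) (by positivity))
  have hgj : ∀ᶠ q : ℝ × W m n 1 in 𝓝 (0, A₀), |g q.2 j - g A₀ j| < ε / 2 := by
    have h1 : ContinuousAt (fun A => |g A j - g A₀ j|) A₀ := by
      have := continuousAt_pi.1 hg j
      fun_prop
    have h2 : ContinuousAt (fun q : ℝ × W m n 1 => |g q.2 j - g A₀ j|) (0, A₀) :=
      ContinuousAt.comp (g := fun A => |g A j - g A₀ j|) h1 continuousAt_snd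
    exact h2.eventually_lt continuousAt_const (by simpa using hε)
  filter_upwards [hsh, hgj] with q hq hgq t ht
  have hsum : ∑ i, g A₀ i * ((shear (Pi.single j 1) p (linCoeff b j) q.1 t q.2).1 i - q.2.1 i) =
      q.1 * g A₀ j := by
    simp [shear, Pi.single_apply, mul_comm]
  have h1 := hq t ht
  rw [hsum, sigma_shear hskew h0] at h1
  have h2 : √(|q.1 * (t - ψ q.2)| * enorm p) ≤ (|q.1| + |t - ψ q.2|) * √(enorm p) := by
    rw [Real.sqrt_mul (abs_nonneg _), abs_mul]
    refine mul_le_mul_of_nonneg_right ?_ (Real.sqrt_nonneg _)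
    have ha := abs_nonneg q.1
    have hb := abs_nonneg (t - ψ q.2)
    exact Real.sqrt_le_iff.2 ⟨by positivity, by nlinarith⟩
  have h3 : |q.1| + √(|q.1 * (t - ψ q.2)| * enorm p) ≤ K * (|q.1| + |t - ψ q.2|) := by
    rw [hK]
    linarith [abs_nonneg (t - ψ q.2)]
  have h4 := h1.trans (mul_le_mul_of_nonneg_left h3 (by positivity))
  have h5 : ε / 2 / K * (K * (|q.1| + |t - ψ q.2|)) = ε / 2 * (|q.1| + |t - ψ q.2|) := by
    field_simp
  rw [h5] at h4
  have h6 : |q.1 * (g q.2 j - g A₀ j)| ≤ ε / 2 * |q.1| := by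
    rw [abs_mul, mul_comm]
    exact mul_le_mul_of_nonneg_right hgq.le (abs_nonneg _)
  have h7 := abs_sub (ψ (shear (Pi.single j 1) p (linCoeff b j) q.1 t q.2) - ψ q.2 -
    q.1 * g A₀ j) (q.1 * (g q.2 j - g A₀ j))
  have h8 : 0 ≤ ε / 2 * |t - ψ q.2| := by positivity
  refine le_trans (le_of_eq ?_) (h7.trans ?_)
  · ring_nf
  · linarith

lemma fderiv_zero_prod_eq_sum {X : Type*} [NormedAddCommGroup X] [NormedSpace ℝ X]
    (L : X × (Fin n → ℝ) →L[ℝ] ℝ) (y : Fin n → ℝ) :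
    L (0, y) = ∑ s, y s * L (0, Pi.single s 1) := by
  have hy : ((0, y) : X × (Fin n → ℝ)) = ∑ s, y s • ((0, Pi.single s 1) : X × (Fin n → ℝ)) := by
    refine Prod.ext ?_ ?_
    · simp [Prod.fst_sum]
    · ext i
      simp [Prod.snd_sum, Finset.sum_apply, Pi.single_apply]
  rw [hy, map_sum]
  simp only [map_smul, smul_eq_mul]

end Distribution

/-- If `{f = 0} ∩ U` is the intrinsic graph of a continuous
`ψ : 𝒪 → ℝ`, with `f ∈ C¹_G(U)` and `X₁f > 0`, then (i) `ψ` is uniformly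
intrinsically differentiable on `𝒪` with continuous intrinsic gradient
`∇^ψψ = −(X₂f/X₁f,…,X_mf/X₁f) ∘ Φ`, and (ii) the equations `D_j^ψψ = w_j` hold in
the sense of distributions. -/
theorem statement9 (m n : ℕ) (hm : 2 ≤ m) (hn : 1 ≤ n)
    (b : Fin n → Matrix (Fin m) (Fin m) ℝ)
    (hskew : ∀ s, (b s).transpose = -(b s)) (hind : LinearIndependent ℝ b)
    (U : Set (G m n)) (hU : IsOpen U)
    (f : G m n → ℝ) (gradf : G m n → Fin m → ℝ)
    (hf : C1Gs m n b U f gradf)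
    (hX1 : ∀ Q ∈ U, 0 < gradf Q ⟨0, by omega⟩)
    (O : Set (W m n 1)) (hO : IsOpen O)
    (ψ : W m n 1 → ℝ) (hψ : ContinuousOn ψ O)
    (hsub : ∀ A ∈ O, graphMapS m n b ψ A ∈ U)
    (hgraph : {P | P ∈ U ∧ f P = 0} = graphMapS m n b ψ '' O) :
    (∀ A ∈ O, UIDs m n b O ψ A
        (fun i => -(gradf (graphMapS m n b ψ A) (idx1 m i) /
          gradf (graphMapS m n b ψ A) ⟨0, by omega⟩))) ∧
    ContinuousOn (fun A => fun i : Fin (m - 1) =>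
        -(gradf (graphMapS m n b ψ A) (idx1 m i) /
          gradf (graphMapS m n b ψ A) ⟨0, by omega⟩)) O ∧
    (∀ η : W m n 1 → ℝ, ContDiff ℝ (⊤ : ℕ∞) η → HasCompactSupport η → tsupport η ⊆ O →
      ∀ j : Fin (m - 1),
        (∫ A in O, (ψ A * fderiv ℝ η A ((Pi.single j 1 : Fin (m - 1) → ℝ), (0 : Fin n → ℝ)) +
          ∑ s, ((1 / 2) * (ψ A) ^ 2 * b s (idx1 m j) ⟨0, by omega⟩ +
              (1 / 2) * (∑ l, A.1 l * b s (idx1 m j) (idx1 m l)) * ψ A) *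
            fderiv ℝ η A ((0 : Fin (m - 1) → ℝ), (Pi.single s 1 : Fin n → ℝ)))) =
        -∫ A in O, (-(gradf (graphMapS m n b ψ A) (idx1 m j) /
            gradf (graphMapS m n b ψ A) ⟨0, by omega⟩)) * η A) := by
  have h0 : 0 < m := by omega
  have hzero : ∀ A ∈ O, f (graphMapS m n b ψ A) = 0 := fun A hA =>
    (hgraph.symm.subset (mem_image_of_mem _ hA)).2
  have hunif := fun (A : W m n 1) (hA : A ∈ O) (ε : ℝ) (hε : ε > 0) =>
    eventually_abs_sub_le_sigma hskew hind h0 hU hf hX1 hO hψ hsub hzero hA hε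
  have hcont := continuousOn_levelGrad h0 hU hf hX1 hO hψ hsub
  refine ⟨fun A hA => UIDs.of_eventually hskew (hunif A hA), hcont, fun η hη hc hs j => ?_⟩
  have hweak := integral_weak_form hO hψ (w := fun A => levelGrad b h0 gradf ψ A j)
    ((continuous_apply j).comp_continuousOn hcont) (Pi.single j 1)
    (fun s => b s (idx1 m j) ⟨0, h0⟩) (linCoeff b j) (linCoeff_single_self hskew j)
    (fun M A₀ hA₀ ε hε => eventually_shear_increment_le hskew h0
      (hcont.continuousAt (hO.mem_nhds hA₀)) (hunif A₀ hA₀) j M hε)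
    (hη.of_le (by exact_mod_cast le_top)) hc hs
  refine Eq.trans (integral_congr_ae (Eventually.of_forall fun A => ?_)) hweak
  simp only
  rw [fderiv_zero_prod_eq_sum _ (linCoeff b j A.1),
    fderiv_zero_prod_eq_sum _ fun s => b s (idx1 m j) ⟨0, h0⟩, mul_add, add_assoc, Finset.mul_sum,
    Finset.mul_sum, ← Finset.sum_add_distrib]
  congr 1
  refine Finset.sum_congr rfl fun s _ => ?_
  rw [linCoeff_apply]
  ring
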